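/- arXiv:2206.13075 — 9 statements merged into one kernel-verified Lean document; each statement's English description precedes it below -/
import Mathlib

section
/- Let n ≥ 1 and 0 < s < 1. For every bounded continuous real-valued function f on ℝⁿ one has ‖ |f| ‖_{C^s} ≤ ‖f‖_{C^s} and ‖f‖_{C^s} ≤ 2·‖ |f| ‖_{C^s}, where both sides are taken in the extended reals [0,∞]. In particular a real bounded continuous f belongs to the Hölder–Zygmund space C^s(ℝⁿ) if, and only if, |f| belongs to it, with equivalent norms (the perfect truncation property of C^s(ℝⁿ)). -/
open scoped ENNReal

/-- The Hölder–Zygmund norm of `C^s(ℝⁿ)`: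
`‖f‖_{C^s} = sup_x |f(x)| + sup_{0<|x−y|≤1} |f(x)−f(y)|/|x−y|^s`, valued in `[0,∞]`. -/
noncomputable def hzNorm (n : ℕ) (s : ℝ) (f : EuclideanSpace ℝ (Fin n) → ℝ) : ℝ≥0∞ :=
  (⨆ x : EuclideanSpace ℝ (Fin n), ENNReal.ofReal |f x|) +
  ⨆ (p : EuclideanSpace ℝ (Fin n) × EuclideanSpace ℝ (Fin n))
    (_ : 0 < dist p.1 p.2 ∧ dist p.1 p.2 ≤ 1),
      ENNReal.ofReal (|f p.1 - f p.2| / dist p.1 p.2 ^ s)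

/-- A continuous function of opposite signs at `x` and `y` vanishes at a point between them. -/
lemma exists_eq_zero_dist_le_of_neg_of_pos {E : Type*} [NormedAddCommGroup E] [NormedSpace ℝ E]
    {f : E → ℝ} (hc : Continuous f) {x y : E} (hx : f x < 0) (hy : 0 < f y) :
    ∃ z, f z = 0 ∧ dist x z ≤ dist x y ∧ dist y z ≤ dist x y := by
  obtain ⟨z, hz, hfz⟩ := (convex_segment (𝕜 := ℝ) x y).isPreconnected.intermediate_value
    (left_mem_segment ℝ x y) (right_mem_segment ℝ x y) hc.continuousOn ⟨hx.le, hy.le⟩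
  have h := dist_add_dist_of_mem_segment hz
  have h₁ := dist_nonneg (x := x) (y := z)
  have h₂ := dist_nonneg (x := z) (y := y)
  exact ⟨z, hfz, by linarith, by rw [dist_comm y z]; linarith⟩

/-- If the Hölder quotients of `|f|` at scale at most one are bounded by `B`, then at a point `x`
with `f x ≠ 0`, the value `|f x|` is controlled by the distance to a nearby zero of `f`. -/
lemma ofReal_abs_div_rpow_le_of_eq_zero {E : Type*} [MetricSpace E] {s : ℝ} (hs : 0 ≤ s)
    {f : E → ℝ} {B : ℝ≥0∞}
    (hB : ∀ x y, 0 < dist x y → dist x y ≤ 1 →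
      ENNReal.ofReal (|(|f x| - |f y|)| / dist x y ^ s) ≤ B)
    {x z : E} {d : ℝ} (hx : f x ≠ 0) (hz : f z = 0) (hd : dist x z ≤ d) (hd1 : d ≤ 1) :
    ENNReal.ofReal (|f x| / d ^ s) ≤ B := by
  have hxz : 0 < dist x z := dist_pos.mpr fun h => hx (h ▸ hz)
  refine le_trans (ENNReal.ofReal_le_ofReal ?_) (hB x z hxz (hd.trans hd1))
  rw [hz, abs_zero, sub_zero, abs_abs]
  gcongr

/-- Hölder bounds at scale at most one pass from `|f|` to `f` at the cost of a factor two. -/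
lemma ofReal_abs_sub_div_rpow_le_two_mul {E : Type*} [NormedAddCommGroup E] [NormedSpace ℝ E]
    {s : ℝ} (hs : 0 ≤ s) {f : E → ℝ} (hc : Continuous f) {B : ℝ≥0∞}
    (hB : ∀ x y, 0 < dist x y → dist x y ≤ 1 →
      ENNReal.ofReal (|(|f x| - |f y|)| / dist x y ^ s) ≤ B)
    {x y : E} (hxy : 0 < dist x y) (hxy1 : dist x y ≤ 1) :
    ENNReal.ofReal (|f x - f y| / dist x y ^ s) ≤ 2 * B := by
  have key : ∀ z, f z = 0 → dist x z ≤ dist x y → dist y z ≤ dist x y → f x ≠ 0 → f y ≠ 0 →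
      ENNReal.ofReal (|f x - f y| / dist x y ^ s) ≤ 2 * B := by
    intro z hz hxz hyz hx hy
    calc ENNReal.ofReal (|f x - f y| / dist x y ^ s)
        ≤ ENNReal.ofReal (|f x| / dist x y ^ s + |f y| / dist x y ^ s) := by
          rw [← add_div]
          gcongr
          exact abs_sub _ _
      _ ≤ ENNReal.ofReal (|f x| / dist x y ^ s) + ENNReal.ofReal (|f y| / dist x y ^ s) :=
          ENNReal.ofReal_add_le
      _ ≤ B + B := add_le_add (ofReal_abs_div_rpow_le_of_eq_zero hs hB hx hz hxz hxy1)
          (ofReal_abs_div_rpow_le_of_eq_zero hs hB hy hz hyz hxy1)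
      _ = 2 * B := (two_mul B).symm
  have same : |f x - f y| = |(|f x| - |f y|)| →
      ENNReal.ofReal (|f x - f y| / dist x y ^ s) ≤ 2 * B := by
    intro h
    rw [h, two_mul]
    exact (hB x y hxy hxy1).trans le_self_add
  rcases le_or_gt 0 (f x) with hx | hx <;> rcases le_or_gt 0 (f y) with hy | hy
  · exact same (by rw [abs_of_nonneg hx, abs_of_nonneg hy])
  · rcases hx.eq_or_lt with hx | hx
    · exact same (by rw [← hx]; simp)
    · obtain ⟨z, hz, hyz, hxz⟩ := exists_eq_zero_dist_le_of_neg_of_pos hc hy hx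
      rw [dist_comm y x] at hyz hxz
      exact key z hz hxz hyz hx.ne' hy.ne
  · rcases hy.eq_or_lt with hy | hy
    · exact same (by rw [← hy]; simp)
    · obtain ⟨z, hz, hxz, hyz⟩ := exists_eq_zero_dist_le_of_neg_of_pos hc hx hy
      exact key z hz hxz hyz hx.ne hy.ne'
  · exact same (by rw [abs_of_neg hx, abs_of_neg hy, neg_sub_neg, abs_sub_comm])

lemma hzNorm_abs_le (n : ℕ) (s : ℝ) (f : EuclideanSpace ℝ (Fin n) → ℝ) :
    hzNorm n s (fun x => |f x|) ≤ hzNorm n s f := by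
  unfold hzNorm
  refine add_le_add (by simp only [abs_abs, le_refl]) (iSup₂_mono fun p _ => ?_)
  exact ENNReal.ofReal_le_ofReal (div_le_div_of_nonneg_right
    (abs_abs_sub_abs_le (f p.1) (f p.2)) (Real.rpow_nonneg dist_nonneg s))

lemma hzNorm_le_two_mul_hzNorm_abs (n : ℕ) {s : ℝ} (hs : 0 ≤ s)
    {f : EuclideanSpace ℝ (Fin n) → ℝ} (hc : Continuous f) :
    hzNorm n s f ≤ 2 * hzNorm n s (fun x => |f x|) := by
  unfold hzNorm
  rw [mul_add]
  refine add_le_add ?_ (iSup₂_le fun p hp => ?_)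
  · simp only [abs_abs, two_mul, le_self_add]
  · refine ofReal_abs_sub_div_rpow_le_two_mul hs hc (fun x y h h1 => ?_) hp.1 hp.2
    exact le_iSup₂_of_le (x, y) ⟨h, h1⟩ le_rfl

/-- perfect truncation property of the Hölder–Zygmund space `C^s(ℝⁿ)`,
`0 < s < 1`: for bounded continuous real `f`, `‖|f|‖_{C^s} ≤ ‖f‖_{C^s} ≤ 2‖|f|‖_{C^s}`;
in particular `f ∈ C^s(ℝⁿ)` iff `|f| ∈ C^s(ℝⁿ)`. -/
theorem perfect_truncation_Cs (n : ℕ) (hn : 1 ≤ n) (s : ℝ) (hs0 : 0 < s) (hs1 : s < 1)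
    (f : EuclideanSpace ℝ (Fin n) → ℝ)
    (hb : ∃ M, ∀ x, |f x| ≤ M) (hc : Continuous f) :
    hzNorm n s (fun x => |f x|) ≤ hzNorm n s f ∧
    hzNorm n s f ≤ 2 * hzNorm n s (fun x => |f x|) ∧
    (hzNorm n s f < ∞ ↔ hzNorm n s (fun x => |f x|) < ∞) := by
  have h₁ := hzNorm_abs_le n s f
  have h₂ := hzNorm_le_two_mul_hzNorm_abs n hs0.le hc
  exact ⟨h₁, h₂, h₁.trans_lt, fun h => h₂.trans_lt (ENNReal.mul_lt_top ENNReal.ofNat_lt_top h)⟩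
end

section
/- Let g : ℝ → ℝ be a Lipschitz scaling function with constants 0 < L₁ ≤ L₂ < ∞. Let Q be a nonempty preconnected subset of ℝⁿ and let f : ℝⁿ → ℝ be continuous on Q and bounded on Q. Then (L₁/2)·osc_Q(f) ≤ osc_Q(|g ∘ f|) ≤ L₂·osc_Q(f), where |g ∘ f|(x) = |g(f(x))| and osc_Q(u) = sup_{x∈Q} u(x) − inf_{x∈Q} u(x). -/
/-- The oscillation of a real-valued function over a set:
`osc_Q(u) = sup_{x∈Q} u(x) − inf_{x∈Q} u(x)`. -/
noncomputable def oscOn {X : Type*} (u : X → ℝ) (Q : Set X) : ℝ :=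
  sSup (u '' Q) - sInf (u '' Q)

/-- The oscillation over a nonempty set is at most any bound on the differences of values. -/
theorem oscOn_le_of_forall_sub_le {X : Type*} {u : X → ℝ} {Q : Set X} {c : ℝ}
    (hQ : Q.Nonempty) (h : ∀ x ∈ Q, ∀ y ∈ Q, u x - u y ≤ c) : oscOn u Q ≤ c := by
  have hsup : sSup (u '' Q) ≤ c + sInf (u '' Q) := by
    refine csSup_le (hQ.image u) ?_
    rintro _ ⟨x, hx, rfl⟩
    have hinf : u x - c ≤ sInf (u '' Q) := by
      refine le_csInf (hQ.image u) ?_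
      rintro _ ⟨y, hy, rfl⟩
      linarith [h x hx y hy]
    linarith
  unfold oscOn
  linarith

/-- Differences of values of a bounded function are at most its oscillation. -/
theorem sub_le_oscOn {X : Type*} {u : X → ℝ} {Q : Set X} {M : ℝ}
    (hM : ∀ x ∈ Q, |u x| ≤ M) {x y : X} (hx : x ∈ Q) (hy : y ∈ Q) :
    u x - u y ≤ oscOn u Q := by
  have hsup : u x ≤ sSup (u '' Q) := by
    refine le_csSup ⟨M, ?_⟩ ⟨x, hx, rfl⟩
    rintro _ ⟨z, hz, rfl⟩
    exact (abs_le.mp (hM z hz)).2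
  have hinf : sInf (u '' Q) ≤ u y := by
    refine csInf_le ⟨-M, ?_⟩ ⟨y, hy, rfl⟩
    rintro _ ⟨z, hz, rfl⟩
    exact (abs_le.mp (hM z hz)).1
  unfold oscOn
  linarith

/-- if `g` is a Lipschitz scaling function with constants `0 < L₁ ≤ L₂ < ∞`,
`Q ⊆ ℝⁿ` nonempty and preconnected, and `f` continuous and bounded on `Q`, then
`(L₁/2)·osc_Q(f) ≤ osc_Q(|g ∘ f|) ≤ L₂·osc_Q(f)`. -/
theorem osc_abs_lipschitz_scaling_comp (n : ℕ) (g : ℝ → ℝ) (L₁ L₂ : ℝ)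
    (hL₁ : 0 < L₁) (hL₁₂ : L₁ ≤ L₂) (hg0 : g 0 = 0)
    (hg : ∀ t₁ t₂ : ℝ, t₁ ≤ t₂ →
      L₁ * (t₂ - t₁) ≤ g t₂ - g t₁ ∧ g t₂ - g t₁ ≤ L₂ * (t₂ - t₁))
    (Q : Set (EuclideanSpace ℝ (Fin n))) (hQne : Q.Nonempty) (hQconn : IsPreconnected Q)
    (f : EuclideanSpace ℝ (Fin n) → ℝ)
    (hcont : ContinuousOn f Q) (hbdd : ∃ M, ∀ x ∈ Q, |f x| ≤ M) :
    (L₁ / 2) * oscOn f Q ≤ oscOn (fun x => |g (f x)|) Q ∧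
    oscOn (fun x => |g (f x)|) Q ≤ L₂ * oscOn f Q := by
  obtain ⟨M, hM⟩ := hbdd
  have hL₂ : 0 < L₂ := hL₁.trans_le hL₁₂
  have hlip : ∀ a b : ℝ, |g a - g b| ≤ L₂ * |a - b| := by
    intro a b
    wlog hab : b ≤ a generalizing a b
    · rw [abs_sub_comm (g a), abs_sub_comm a]
      exact this b a (le_of_not_ge hab)
    have h := hg b a hab
    have h0 : 0 ≤ L₁ * (a - b) := mul_nonneg hL₁.le (sub_nonneg.mpr hab)
    rw [abs_of_nonneg (sub_nonneg.mpr hab), abs_of_nonneg (h0.trans h.1)]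
    exact h.2
  have hgM : ∀ x ∈ Q, |(fun x => |g (f x)|) x| ≤ L₂ * M := by
    intro x hx
    have h := hlip (f x) 0
    rw [hg0, sub_zero, sub_zero] at h
    simpa using h.trans (mul_le_mul_of_nonneg_left (hM x hx) hL₂.le)
  have hpos : ∀ t, 0 ≤ t → L₁ * t ≤ g t := fun t ht => by
    simpa [hg0] using (hg 0 t ht).1
  have hneg : ∀ t, t ≤ 0 → L₁ * -t ≤ -g t := fun t ht => by
    simpa [hg0] using (hg t 0 ht).1
  have hpos' : ∀ t, 0 ≤ t → |g t| = g t := fun t ht =>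
    abs_of_nonneg ((mul_nonneg hL₁.le ht).trans (hpos t ht))
  have hneg' : ∀ t, t ≤ 0 → |g t| = -g t := fun t ht =>
    abs_of_nonpos (neg_nonneg.mp ((mul_nonneg hL₁.le (neg_nonneg.mpr ht)).trans (hneg t ht)))
  have hosc : ∀ x ∈ Q, ∀ y ∈ Q, |g (f x)| - |g (f y)| ≤ oscOn (fun x => |g (f x)|) Q :=
    fun x hx y hy => sub_le_oscOn hgM hx hy
  constructor
  · have key : oscOn f Q ≤ 2 * oscOn (fun x => |g (f x)|) Q / L₁ := by
      refine oscOn_le_of_forall_sub_le hQne fun x hx y hy => ?_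
      rw [le_div_iff₀ hL₁]
      have hxx := hosc x hx x hx
      have hxy := hosc x hx y hy
      have hyx := hosc y hy x hx
      rcases le_total (f x) (f y) with hle | hle
      · nlinarith
      have hd := (hg _ _ hle).1
      rcases le_total 0 (f y) with hy0 | hy0
      · rw [hpos' _ hy0, hpos' _ (hy0.trans hle)] at hxy
        linarith
      rcases le_total (f x) 0 with hx0 | hx0
      · rw [hneg' _ hy0, hneg' _ hx0] at hyx
        linarith
      obtain ⟨z, hz, hfz⟩ := hQconn.intermediate_value hy hx hcont ⟨hy0, hx0⟩
      have hxz := hosc x hx z hz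
      have hyz := hosc y hy z hz
      rw [hfz, hg0, abs_zero, sub_zero] at hxz hyz
      rw [hpos' _ hx0] at hxz
      rw [hneg' _ hy0] at hyz
      linarith [hpos _ hx0, hneg _ hy0]
    rw [le_div_iff₀ hL₁] at key
    linarith
  · refine oscOn_le_of_forall_sub_le hQne fun x hx y hy => ?_
    have habs : |f x - f y| ≤ oscOn f Q :=
      abs_sub_le_iff.mpr ⟨sub_le_oscOn hM hx hy, sub_le_oscOn hM hy hx⟩
    exact (abs_sub_abs_le_abs_sub _ _).trans
      ((hlip _ _).trans (mul_le_mul_of_nonneg_left habs hL₂.le))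
end

section
/- Let n ≥ 1 and j ≥ 1 be natural numbers and define f_j : ℝⁿ → ℝ by f_j(x) = Σ_{m ∈ {0,1,…,2^j−1}^n} Π_{l=1}^n h_M(2^j x_l − m_l). Then f_j(x) = 0 for every x outside (0,1)^n, |f_j(x)| = 1 for every x ∈ (0,1)^n all of whose coordinates are not integer multiples of 2^{−j−1}, and consequently |f_j| coincides Lebesgue-almost everywhere on ℝⁿ with the characteristic function of the unit cube Q = (0,1)^n. -/
open MeasureTheory
open scoped BigOperators

/-- The Haar function `h_M`. -/
noncomputable def haarM (y : ℝ) : ℝ :=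
  if 0 < y ∧ y < 1 / 2 then 1 else if 1 / 2 ≤ y ∧ y < 1 then -1 else 0

/-- `f_j(x) = Σ_{m ∈ {0,…,2^j−1}^n} Π_{l=1}^n h_M(2^j x_l − m_l)`. -/
noncomputable def haarSum (n j : ℕ) (x : Fin n → ℝ) : ℝ :=
  ∑ m : Fin n → Fin (2 ^ j), ∏ l : Fin n, haarM (2 ^ j * x l - (m l : ℝ))

/-- The open unit cube `(0,1)^n` in `ℝⁿ`. -/
def unitCube (n : ℕ) : Set (Fin n → ℝ) := {x | ∀ l, 0 < x l ∧ x l < 1}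

theorem haarM_eq_zero {y : ℝ} (h : y ≤ 0 ∨ 1 ≤ y) : haarM y = 0 := by
  unfold haarM
  rcases h with h | h
  · rw [if_neg (fun h' => by linarith [h'.1]), if_neg (fun h' => by linarith [h'.1])]
  · rw [if_neg (fun h' => by linarith [h'.2]), if_neg (fun h' => by linarith [h'.2])]

theorem abs_haarM_eq_one {y : ℝ} (h₀ : 0 < y) (h₁ : y < 1) : |haarM y| = 1 := by
  unfold haarM
  rcases lt_or_ge y (1 / 2) with h | h
  · rw [if_pos ⟨h₀, h⟩, abs_one]
  · rw [if_neg (fun h' => by linarith [h'.2]), if_pos ⟨h, h₁⟩, abs_neg, abs_one]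

theorem haarSum_eq_prod (n j : ℕ) (x : Fin n → ℝ) :
    haarSum n j x = ∏ l, ∑ k : Fin (2 ^ j), haarM (2 ^ j * x l - (k : ℝ)) := by
  rw [Finset.prod_univ_sum, Fintype.piFinset_univ, haarSum]

theorem sum_haarM_eq_zero {N : ℕ} {y : ℝ} (h : y ≤ 0 ∨ (N : ℝ) ≤ y) :
    ∑ k : Fin N, haarM (y - (k : ℝ)) = 0 := by
  refine Finset.sum_eq_zero fun k _ => haarM_eq_zero ?_
  have hk₀ : (0 : ℝ) ≤ (k : ℕ) := Nat.cast_nonneg _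
  have hk₁ : ((k : ℕ) : ℝ) + 1 ≤ N := by exact_mod_cast k.isLt
  rcases h with h | h
  · left; linarith
  · right; linarith

theorem abs_sum_haarM_eq_one {N : ℕ} {y : ℝ} (h₀ : 0 < y) (h₁ : y < N)
    (hy : ∀ k : ℕ, y ≠ k) : |∑ k : Fin N, haarM (y - (k : ℝ))| = 1 := by
  have hle := Nat.floor_le h₀.le
  have hlt := Nat.lt_floor_add_one y
  have hfloor : ⌊y⌋₊ < N := (Nat.floor_lt h₀.le).2 h₁
  rw [Finset.sum_eq_single ⟨⌊y⌋₊, hfloor⟩]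
  · refine abs_haarM_eq_one (sub_pos.2 (lt_of_le_of_ne hle (hy _).symm)) ?_
    dsimp only
    linarith
  · intro k _ hk
    have hk' : (k : ℕ) ≠ ⌊y⌋₊ := fun h => hk (Fin.ext h)
    apply haarM_eq_zero
    rcases lt_or_gt_of_ne hk' with h | h
    · right
      have : ((k : ℕ) : ℝ) + 1 ≤ ⌊y⌋₊ := by exact_mod_cast h
      linarith
    · left
      have : (⌊y⌋₊ : ℝ) + 1 ≤ (k : ℕ) := by exact_mod_cast h
      linarith
  · exact fun h => absurd (Finset.mem_univ _) h

theorem haarSum_eq_zero {n j : ℕ} {x : Fin n → ℝ} (hx : x ∉ unitCube n) :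
    haarSum n j x = 0 := by
  have hpow : (0 : ℝ) < 2 ^ j := by positivity
  obtain ⟨l, hl⟩ := not_forall.1 hx
  rw [haarSum_eq_prod]
  refine Finset.prod_eq_zero (Finset.mem_univ l) (sum_haarM_eq_zero ?_)
  push_cast
  rcases le_or_gt (x l) 0 with h | h
  · left; exact mul_nonpos_of_nonneg_of_nonpos hpow.le h
  · right; exact le_mul_of_one_le_right hpow.le (not_lt.1 fun h' => hl ⟨h, h'⟩)

theorem abs_haarSum_eq_one {n j : ℕ} {x : Fin n → ℝ} (hx : x ∈ unitCube n)
    (hne : ∀ l : Fin n, ∀ k : ℤ, x l ≠ (k : ℝ) * (2 : ℝ) ^ (-(j : ℤ) - 1)) :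
    |haarSum n j x| = 1 := by
  have hpow : (0 : ℝ) < 2 ^ j := by positivity
  rw [haarSum_eq_prod, Finset.abs_prod]
  refine Finset.prod_eq_one fun l _ => abs_sum_haarM_eq_one (mul_pos hpow (hx l).1) ?_ ?_
  · push_cast
    exact mul_lt_of_lt_one_right hpow (hx l).2
  · intro k hk
    apply hne l (2 * k)
    rw [zpow_sub₀ two_ne_zero, zpow_neg, zpow_natCast, zpow_one]
    push_cast
    rw [← hk]
    field_simp

theorem ae_forall_coord_ne {ι : Type*} [Fintype ι] (c : ℤ → ℝ) :
    ∀ᵐ x : ι → ℝ ∂volume, ∀ l, ∀ k, x l ≠ c k := by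
  refine ae_all_iff.2 fun l => ae_all_iff.2 fun k => ?_
  rw [ae_iff]
  simpa only [not_not, ne_eq, volume_pi] using
    Measure.pi_hyperplane (fun _ : ι => (volume : Measure ℝ)) l (c k)

/-- `f_j` vanishes outside `(0,1)^n`, has `|f_j| = 1` at every point of
`(0,1)^n` whose coordinates avoid the integer multiples of `2^{−j−1}`, and hence `|f_j|`
coincides Lebesgue-a.e. with the characteristic function of the unit cube `(0,1)^n`. -/
theorem haarSum_abs_eq_indicator (n j : ℕ) (hn : 1 ≤ n) (hj : 1 ≤ j) :
    (∀ x : Fin n → ℝ, x ∉ unitCube n → haarSum n j x = 0) ∧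
    (∀ x : Fin n → ℝ, x ∈ unitCube n →
      (∀ l : Fin n, ∀ k : ℤ, x l ≠ (k : ℝ) * (2 : ℝ) ^ (-(j : ℤ) - 1)) →
      |haarSum n j x| = 1) ∧
    (∀ᵐ x : Fin n → ℝ ∂volume,
      |haarSum n j x| = Set.indicator (unitCube n) (fun _ => (1 : ℝ)) x) := by
  refine ⟨fun _ hx => haarSum_eq_zero hx, fun _ hx hne => abs_haarSum_eq_one hx hne, ?_⟩
  filter_upwards [ae_forall_coord_ne fun k : ℤ => (k : ℝ) * (2 : ℝ) ^ (-(j : ℤ) - 1)]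
    with x hne
  by_cases hx : x ∈ unitCube n
  · rw [Set.indicator_of_mem hx, abs_haarSum_eq_one hx hne]
  · rw [Set.indicator_of_notMem hx, haarSum_eq_zero hx, abs_zero]
end

section
/- Let f : ℝ → ℝ be continuous with support contained in [0,1]. Then the Faber series of f converges to f uniformly on ℝ: the partial sums S_J f(x) = −(1/2) Σ_{j=0}^{J} Σ_{m=0}^{2^j−1} (Δ²_{2^{−j−1}} f)(2^{−j} m) · v_{j,m}(x) satisfy sup_{x∈ℝ} |S_J f(x) − f(x)| → 0 as J → ∞. -/
open scoped BigOperators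

/-- The Faber hat function `v_{j,m}`. -/
noncomputable def faberHat (j : ℕ) (m : ℤ) (x : ℝ) : ℝ :=
  if (2 : ℝ) ^ (-(j : ℤ)) * m ≤ x ∧ x < (2 : ℝ) ^ (-(j : ℤ)) * m + (2 : ℝ) ^ (-(j : ℤ) - 1)
    then (2 : ℝ) ^ ((j : ℤ) + 1) * (x - (2 : ℝ) ^ (-(j : ℤ)) * m)
  else if (2 : ℝ) ^ (-(j : ℤ)) * m + (2 : ℝ) ^ (-(j : ℤ) - 1) ≤ x ∧
          x < (2 : ℝ) ^ (-(j : ℤ)) * (m + 1)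
    then (2 : ℝ) ^ ((j : ℤ) + 1) * ((2 : ℝ) ^ (-(j : ℤ)) * (m + 1) - x)
  else 0

/-- The second difference `(Δ²_h f)(x) = f(x+2h) − 2f(x+h) + f(x)`. -/
def delta2 (h : ℝ) (f : ℝ → ℝ) (x : ℝ) : ℝ := f (x + 2 * h) - 2 * f (x + h) + f x

/-- The partial sums of the Faber series of `f`:
`S_J f(x) = −(1/2) Σ_{j=0}^{J} Σ_{m=0}^{2^j−1} (Δ²_{2^{−j−1}} f)(2^{−j}m) · v_{j,m}(x)`. -/
noncomputable def faberPartialSum (f : ℝ → ℝ) (J : ℕ) (x : ℝ) : ℝ :=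
  -(1 / 2 : ℝ) * ∑ j ∈ Finset.range (J + 1), ∑ m ∈ Finset.range (2 ^ j),
    delta2 ((2 : ℝ) ^ (-(j : ℤ) - 1)) f ((2 : ℝ) ^ (-(j : ℤ)) * (m : ℤ)) * faberHat j (m : ℤ) x

/-- The piecewise linear interpolant of `f` at the dyadic points `k / 2 ^ j`, `k ∈ ℤ`. -/
noncomputable def dyadicInterp (f : ℝ → ℝ) (j : ℕ) (x : ℝ) : ℝ :=
  (1 - Int.fract (2 ^ j * x)) * f (⌊2 ^ j * x⌋ / 2 ^ j) +
    Int.fract (2 ^ j * x) * f ((⌊2 ^ j * x⌋ + 1) / 2 ^ j)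

theorem dyadicInterp_eq (f : ℝ → ℝ) {j : ℕ} {x : ℝ} {k : ℤ} (h₁ : k ≤ 2 ^ j * x)
    (h₂ : 2 ^ j * x < k + 1) :
    dyadicInterp f j x =
      (k + 1 - 2 ^ j * x) * f (k / 2 ^ j) + (2 ^ j * x - k) * f ((k + 1) / 2 ^ j) := by
  have hk : ⌊2 ^ j * x⌋ = k := Int.floor_eq_iff.2 ⟨h₁, h₂⟩
  rw [dyadicInterp, Int.fract, hk]
  ring

/-- The hat function `v_{j,m}` in the rescaled variable `2 ^ j * x`. -/
theorem faberHat_eq (j : ℕ) (m : ℤ) (x : ℝ) :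
    faberHat j m x =
      if m ≤ 2 ^ j * x ∧ 2 ^ j * x < m + 1 / 2 then 2 * (2 ^ j * x - m)
      else if m + 1 / 2 ≤ 2 ^ j * x ∧ 2 ^ j * x < m + 1 then 2 * (m + 1 - 2 ^ j * x)
      else 0 := by
  have hp : (0 : ℝ) < 2 ^ j := by positivity
  have e₁ : (2 : ℝ) ^ (-(j : ℤ)) = (2 ^ j)⁻¹ := by simp
  have e₂ : (2 : ℝ) ^ (-(j : ℤ) - 1) = (2 ^ j)⁻¹ * (1 / 2) := by
    rw [zpow_sub₀ two_ne_zero, e₁, zpow_one]; ring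
  have e₃ : (2 : ℝ) ^ ((j : ℤ) + 1) = 2 ^ j * 2 := by
    rw [zpow_add₀ two_ne_zero, zpow_natCast, zpow_one]
  have hle (a : ℝ) : (2 ^ j)⁻¹ * a ≤ x ↔ a ≤ 2 ^ j * x := inv_mul_le_iff₀ hp
  have hlt (a : ℝ) : x < (2 ^ j)⁻¹ * a ↔ 2 ^ j * x < a := lt_inv_mul_iff₀ hp
  rw [faberHat, e₁, e₂, e₃]
  simp only [← mul_add, hle, hlt]
  congr 1
  · field_simp
  · congr 1
    field_simp

theorem faberHat_eq_zero {j : ℕ} {m : ℤ} {x : ℝ} (h : m ≠ ⌊2 ^ j * x⌋) :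
    faberHat j m x = 0 := by
  rw [faberHat_eq, if_neg, if_neg]
  · rintro ⟨h₁, h₂⟩
    exact h (Int.floor_eq_iff.2 ⟨by linarith, h₂⟩).symm
  · rintro ⟨h₁, h₂⟩
    exact h (Int.floor_eq_iff.2 ⟨h₁, by linarith⟩).symm

theorem dyadicInterp_succ_sub (f : ℝ → ℝ) (j : ℕ) (x : ℝ) :
    dyadicInterp f (j + 1) x - dyadicInterp f j x =
      -(1 / 2) * (delta2 ((2 : ℝ) ^ (-(j : ℤ) - 1)) f ((2 : ℝ) ^ (-(j : ℤ)) * ⌊2 ^ j * x⌋) *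
        faberHat j ⌊2 ^ j * x⌋ x) := by
  have e₁ : (2 : ℝ) ^ (-(j : ℤ)) = (2 ^ j)⁻¹ := by simp
  have e₂ : (2 : ℝ) ^ (-(j : ℤ) - 1) = (2 ^ j)⁻¹ * (1 / 2) := by
    rw [zpow_sub₀ two_ne_zero, e₁, zpow_one]; ring
  have hn₁ := Int.floor_le (2 ^ j * x)
  have hn₂ := Int.lt_floor_add_one (2 ^ j * x)
  generalize ⌊2 ^ j * x⌋ = n at hn₁ hn₂ ⊢
  have hs : (2 : ℝ) ^ (j + 1) * x = 2 * (2 ^ j * x) := by ring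
  have p₀ : (2 ^ j : ℝ)⁻¹ * n = n / 2 ^ j := by ring
  have p₁ : (n : ℝ) / 2 ^ j + (2 ^ j)⁻¹ * (1 / 2) = (2 * n + 1) / 2 ^ (j + 1) := by
    field_simp; ring
  have p₂ : (n : ℝ) / 2 ^ j + 2 * ((2 ^ j)⁻¹ * (1 / 2)) = (n + 1) / 2 ^ j := by
    field_simp
  have q₀ : (2 * n : ℝ) / 2 ^ (j + 1) = n / 2 ^ j := by field_simp; ring
  have q₂ : (2 * n + 1 + 1 : ℝ) / 2 ^ (j + 1) = (n + 1) / 2 ^ j := by field_simp; ring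
  rw [dyadicInterp_eq f hn₁ hn₂, faberHat_eq, delta2, e₁, e₂, p₀, p₁, p₂]
  rcases lt_or_ge (2 ^ j * x) (n + 1 / 2) with h | h
  · rw [dyadicInterp_eq f (k := 2 * n) (by push_cast; linarith) (by push_cast; linarith),
      if_pos ⟨hn₁, h⟩]
    push_cast
    rw [hs, q₀]
    ring
  · rw [dyadicInterp_eq f (k := 2 * n + 1) (by push_cast; linarith) (by push_cast; linarith),
      if_neg fun h' => h'.2.not_ge h, if_pos ⟨h, hn₂⟩]
    push_cast
    rw [hs, q₂]
    ring

/-- If `f` vanishes outside `(0, 1)`, then so do its dyadic interpolants. -/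
theorem dyadicInterp_eq_zero {f : ℝ → ℝ} (h₀ : ∀ x ≤ 0, f x = 0) (h₁ : ∀ x, 1 ≤ x → f x = 0)
    {j : ℕ} {x : ℝ} (h : ⌊2 ^ j * x⌋ < 0 ∨ 2 ^ j ≤ ⌊2 ^ j * x⌋) : dyadicInterp f j x = 0 := by
  have hp : (0 : ℝ) < 2 ^ j := by positivity
  rw [dyadicInterp]
  rcases h with h | h
  · have h' : (⌊2 ^ j * x⌋ + 1 : ℝ) ≤ 0 := by exact_mod_cast h
    rw [h₀ _ (div_nonpos_of_nonpos_of_nonneg (by linarith) hp.le),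
      h₀ _ (div_nonpos_of_nonpos_of_nonneg h' hp.le)]
    simp
  · have h' : (2 ^ j : ℝ) ≤ ⌊2 ^ j * x⌋ := by exact_mod_cast h
    rw [h₁ _ ((one_le_div hp).2 h'), h₁ _ ((one_le_div hp).2 (by linarith))]
    simp

theorem dyadicInterp_zero {f : ℝ → ℝ} (h₀ : ∀ x ≤ 0, f x = 0) (h₁ : ∀ x, 1 ≤ x → f x = 0)
    (x : ℝ) : dyadicInterp f 0 x = 0 := by
  have hf (k : ℤ) : f k = 0 := by
    rcases le_or_gt k 0 with h | h
    · exact h₀ _ (by exact_mod_cast h)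
    · exact h₁ _ (by exact_mod_cast h)
  have := hf (⌊x⌋ + 1)
  push_cast at this
  simp [dyadicInterp, hf, this]

theorem sum_delta2_mul_faberHat {f : ℝ → ℝ} (h₀ : ∀ x ≤ 0, f x = 0) (h₁ : ∀ x, 1 ≤ x → f x = 0)
    (j : ℕ) (x : ℝ) :
    -(1 / 2 : ℝ) * ∑ m ∈ Finset.range (2 ^ j),
      delta2 ((2 : ℝ) ^ (-(j : ℤ) - 1)) f ((2 : ℝ) ^ (-(j : ℤ)) * (m : ℤ)) *
        faberHat j (m : ℤ) x = dyadicInterp f (j + 1) x - dyadicInterp f j x := by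
  by_cases h : ⌊2 ^ j * x⌋ < 0 ∨ 2 ^ j ≤ ⌊2 ^ j * x⌋
  · have h' : ⌊2 ^ (j + 1) * x⌋ < 0 ∨ 2 ^ (j + 1) ≤ ⌊2 ^ (j + 1) * x⌋ := by
      have hs : (2 : ℝ) ^ (j + 1) * x = 2 * (2 ^ j * x) := by ring
      rw [Int.floor_lt, Int.le_floor] at h ⊢
      push_cast at h ⊢
      rw [hs, pow_succ]
      exact h.imp (fun h => by linarith) (fun h => by linarith)
    rw [dyadicInterp_eq_zero h₀ h₁ h, dyadicInterp_eq_zero h₀ h₁ h', Finset.sum_eq_zero]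
    · simp
    · intro m hm
      have hm' : (m : ℤ) < 2 ^ j := by exact_mod_cast Finset.mem_range.1 hm
      rw [faberHat_eq_zero (by omega), mul_zero]
  · push Not at h
    obtain ⟨n, hn⟩ := Int.eq_ofNat_of_zero_le h.1
    rw [dyadicInterp_succ_sub, hn, Finset.sum_eq_single n]
    · intro m _ hm
      rw [faberHat_eq_zero (by omega), mul_zero]
    · intro hm
      rw [hn] at h
      exact absurd (Finset.mem_range.2 (by exact_mod_cast h.2)) hm

theorem faberPartialSum_eq_dyadicInterp {f : ℝ → ℝ} (h₀ : ∀ x ≤ 0, f x = 0)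
    (h₁ : ∀ x, 1 ≤ x → f x = 0) (J : ℕ) (x : ℝ) :
    faberPartialSum f J x = dyadicInterp f (J + 1) x := by
  rw [faberPartialSum, Finset.mul_sum,
    Finset.sum_congr rfl fun j _ => sum_delta2_mul_faberHat h₀ h₁ j x,
    Finset.sum_range_sub (fun j => dyadicInterp f j x), dyadicInterp_zero h₀ h₁, sub_zero]

theorem tendstoUniformly_dyadicInterp {f : ℝ → ℝ} (hf : UniformContinuous f) :
    TendstoUniformly (dyadicInterp f) f Filter.atTop := by
  rw [Metric.tendstoUniformly_iff]
  intro ε hε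
  obtain ⟨δ, hδ, H⟩ := Metric.uniformContinuous_iff.1 hf ε hε
  obtain ⟨N, hN⟩ := exists_pow_lt_of_lt_one hδ (by norm_num : (1 / 2 : ℝ) < 1)
  filter_upwards [Filter.eventually_ge_atTop N] with j hj x
  have hp : (0 : ℝ) < 2 ^ j := by positivity
  have hj' : (1 : ℝ) / 2 ^ j < δ := by
    rw [← one_div_pow]
    exact (pow_le_pow_of_le_one (by norm_num) (by norm_num) hj).trans_lt hN
  have hn₁ := Int.floor_le (2 ^ j * x)
  have hn₂ := Int.lt_floor_add_one (2 ^ j * x)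
  rw [dyadicInterp_eq f hn₁ hn₂]
  generalize ⌊2 ^ j * x⌋ = n at hn₁ hn₂ ⊢
  have near {a : ℝ} (ha : |a - 2 ^ j * x| ≤ 1) : f (a / 2 ^ j) ∈ Metric.ball (f x) ε := by
    refine H (lt_of_le_of_lt ?_ hj')
    rw [Real.dist_eq, show a / 2 ^ j - x = (a - 2 ^ j * x) / 2 ^ j by field_simp, abs_div,
      abs_of_pos hp]
    gcongr
  rw [dist_comm]
  exact convex_ball (f x) ε (near (abs_le.2 ⟨by linarith, by linarith⟩))
    (near (abs_le.2 ⟨by linarith, by linarith⟩)) (by linarith) (by linarith) (by ring)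

/-- for continuous `f : ℝ → ℝ` with support in `[0,1]`, the Faber series of
`f` converges to `f` uniformly on `ℝ`. -/
theorem faber_series_tendstoUniformly (f : ℝ → ℝ) (hf : Continuous f)
    (hsupp : Function.support f ⊆ Set.Icc 0 1) :
    TendstoUniformly (fun J x => faberPartialSum f J x) f Filter.atTop := by
  have hout {x : ℝ} (hx : x ∉ Set.Icc (0 : ℝ) 1) : f x = 0 :=
    Function.notMem_support.1 fun h => hx (hsupp h)
  have h₀ : ∀ x ≤ 0, f x = 0 := by
    have hcl : IsClosed {x | f x = 0} := isClosed_eq hf continuous_const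
    have := hcl.closure_subset_iff.2
      (fun x (hx : x ∈ Set.Iio 0) => hout fun h => not_lt.2 h.1 hx)
    rwa [closure_Iio] at this
  have h₁ : ∀ x, 1 ≤ x → f x = 0 := by
    have hcl : IsClosed {x | f x = 0} := isClosed_eq hf continuous_const
    have := hcl.closure_subset_iff.2
      (fun x (hx : x ∈ Set.Ioi 1) => hout fun h => not_lt.2 h.2 hx)
    rwa [closure_Ioi] at this
  have huc : UniformContinuous f := hf.uniformContinuous_of_tendsto_cocompact
    (HasCompactSupport.intro isCompact_Icc fun _ => hout).is_zero_at_infty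
  have hS : (fun J x => faberPartialSum f J x) = fun J => dyadicInterp f (J + 1) :=
    funext₂ (faberPartialSum_eq_dyadicInterp h₀ h₁)
  rw [hS]
  exact fun u hu =>
    (Filter.tendsto_add_atTop_nat 1).eventually (tendstoUniformly_dyadicInterp huc u hu)
end

section
/- Let 0 < s < 1. There exist constants c₁ > 0 and c₂ > 0, depending only on s, such that for every continuous f : ℝ → ℝ with support contained in [0,1] one has c₁·D(f) ≤ [f]_s ≤ c₂·D(f) in [0,∞], where D(f) = sup_{j∈ℕ₀} 2^{js} · max_{0≤m≤2^j−1} |(Δ²_{2^{−j−1}} f)(2^{−j} m)| and [f]_s = sup_{x≠y} |f(x)−f(y)|/|x−y|^s. In particular, f is s-Hölder if, and only if, D(f) is finite (the Faber–Schauder characterization of Hölder functions on the interval, i.e. of B^s_{∞,∞} with support in [0,1]). -/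
open scoped ENNReal BigOperators

/-- `D(f) = sup_{j∈ℕ₀} 2^{js} · max_{0≤m≤2^j−1} |(Δ²_{2^{−j−1}} f)(2^{−j}m)|`. -/
noncomputable def faberCoeffSup (s : ℝ) (f : ℝ → ℝ) : ℝ≥0∞ :=
  ⨆ j : ℕ, ENNReal.ofReal ((2 : ℝ) ^ ((j : ℝ) * s) *
    (Finset.range (2 ^ j)).sup' (Finset.nonempty_range_iff.mpr (by positivity))
      fun m => |delta2 ((2 : ℝ) ^ (-(j : ℤ) - 1)) f ((2 : ℝ) ^ (-(j : ℤ)) * (m : ℤ))|)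

/-- The Hölder seminorm `[f]_s = sup_{x≠y} |f(x)−f(y)|/|x−y|^s`, valued in `[0,∞]`. -/
noncomputable def holderSeminorm (s : ℝ) (f : ℝ → ℝ) : ℝ≥0∞ :=
  ⨆ (p : ℝ × ℝ) (_ : p.1 ≠ p.2), ENNReal.ofReal (|f p.1 - f p.2| / |p.1 - p.2| ^ s)

/-- If `|f x - f y| ≤ H |x - y| ^ s`, then second differences satisfy
`|Δ²_h f x| ≤ 2 H h ^ s`. -/
theorem abs_delta2_le_of_holder {s H : ℝ} {f : ℝ → ℝ}
    (hf : ∀ x y, x ≠ y → |f x - f y| ≤ H * |x - y| ^ s) {h : ℝ} (hh : 0 < h) (x : ℝ) :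
    |delta2 h f x| ≤ 2 * (H * h ^ s) := by
  have h1 := hf (x + 2 * h) (x + h) (by linarith)
  have h2 := hf (x + h) x (by linarith)
  rw [show x + 2 * h - (x + h) = h by ring, abs_of_pos hh] at h1
  rw [show x + h - x = h by ring, abs_of_pos hh] at h2
  rw [delta2, show f (x + 2 * h) - 2 * f (x + h) + f x
    = (f (x + 2 * h) - f (x + h)) - (f (x + h) - f x) by ring]
  linarith [abs_sub (f (x + 2 * h) - f (x + h)) (f (x + h) - f x)]

theorem abs_sub_le_of_holderSeminorm_ne_top {s : ℝ} {f : ℝ → ℝ}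
    (hf : holderSeminorm s f ≠ ⊤) {x y : ℝ} (hxy : x ≠ y) :
    |f x - f y| ≤ (holderSeminorm s f).toReal * |x - y| ^ s := by
  have hpos : 0 < |x - y| ^ s := Real.rpow_pos_of_pos (abs_pos.2 (sub_ne_zero.2 hxy)) s
  rw [← div_le_iff₀ hpos, ← ENNReal.ofReal_le_iff_le_toReal hf]
  exact le_iSup₂ (f := fun (p : ℝ × ℝ) (_ : p.1 ≠ p.2) =>
    ENNReal.ofReal (|f p.1 - f p.2| / |p.1 - p.2| ^ s)) (x, y) hxy

theorem holderSeminorm_le_ofReal {s H : ℝ} {f : ℝ → ℝ}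
    (hf : ∀ x y, x ≠ y → |f x - f y| ≤ H * |x - y| ^ s) :
    holderSeminorm s f ≤ ENNReal.ofReal H := by
  refine iSup₂_le fun p hp => ENNReal.ofReal_le_ofReal ?_
  rw [div_le_iff₀ (Real.rpow_pos_of_pos (abs_pos.2 (sub_ne_zero.2 hp)) s)]
  exact hf _ _ hp

theorem two_rpow_neg_pow (s : ℝ) (j : ℕ) :
    ((2 : ℝ) ^ (-s)) ^ j = ((2 : ℝ) ^ ((j : ℝ) * s))⁻¹ := by
  rw [← Real.rpow_natCast, ← Real.rpow_mul (by norm_num), ← Real.rpow_neg (by norm_num)]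
  ring_nf

theorem inv_two_pow_rpow (s : ℝ) (j : ℕ) :
    (((2 : ℝ) ^ j)⁻¹) ^ s = ((2 : ℝ) ^ (-s)) ^ j := by
  rw [two_rpow_neg_pow, Real.inv_rpow (by positivity), ← Real.rpow_natCast,
    ← Real.rpow_mul (by norm_num)]

theorem faberCoeffSup_le_ofReal {s H : ℝ} (hs : 0 < s) (hH : 0 ≤ H) {f : ℝ → ℝ}
    (hf : ∀ x y, x ≠ y → |f x - f y| ≤ H * |x - y| ^ s) :
    faberCoeffSup s f ≤ ENNReal.ofReal (2 * H) := by
  refine iSup_le fun j => ENNReal.ofReal_le_ofReal ?_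
  have hpos : (0 : ℝ) < 2 ^ ((j : ℝ) * s) := by positivity
  rw [mul_comm, ← le_div_iff₀ hpos]
  refine Finset.sup'_le _ _ fun m _ => ?_
  refine (abs_delta2_le_of_holder hf (by positivity) _).trans ?_
  have hle : ((2 : ℝ) ^ (-(j : ℤ) - 1)) ^ s ≤ ((2 : ℝ) ^ ((j : ℝ) * s))⁻¹ := by
    rw [← two_rpow_neg_pow, ← inv_two_pow_rpow]
    refine Real.rpow_le_rpow (by positivity) ?_ hs.le
    rw [← zpow_natCast, ← zpow_neg]
    exact zpow_le_zpow_right₀ (by norm_num) (by linarith)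
  rw [div_eq_mul_inv, mul_assoc]
  gcongr

/-- The second differences entering `D(f)` decay like `2 ^ (-j s)`; outside the unit interval
they vanish. -/
theorem abs_dyadic_delta2_le {s : ℝ} {f : ℝ → ℝ} (hD : faberCoeffSup s f ≠ ⊤)
    (hf : ∀ x, x ≤ 0 ∨ 1 ≤ x → f x = 0) (j : ℕ) (m : ℤ) :
    |f ((m + 1) / 2 ^ j) - 2 * f ((2 * m + 1) / 2 ^ (j + 1)) + f (m / 2 ^ j)| ≤
      (faberCoeffSup s f).toReal * ((2 : ℝ) ^ (-s)) ^ j := by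
  have hR : 0 ≤ (faberCoeffSup s f).toReal * ((2 : ℝ) ^ (-s)) ^ j := by positivity
  have h2 : (0 : ℝ) < 2 ^ j := by positivity
  rcases lt_or_ge m 0 with hm | hm
  · have hm' : (m : ℝ) + 1 ≤ 0 := by exact_mod_cast hm
    rw [hf _ (Or.inl (div_nonpos_of_nonpos_of_nonneg hm' h2.le)),
      hf _ (Or.inl (div_nonpos_of_nonpos_of_nonneg (by linarith) (by positivity))),
      hf _ (Or.inl (div_nonpos_of_nonpos_of_nonneg (by linarith) h2.le))]
    simpa using hR
  rcases le_or_gt ((2 : ℤ) ^ j) m with hm2 | hm2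
  · have hm' : (2 : ℝ) ^ j ≤ m := by exact_mod_cast hm2
    rw [hf _ (Or.inr ((one_le_div h2).2 (by linarith))),
      hf _ (Or.inr ((one_le_div (by positivity)).2 (by rw [pow_succ]; linarith))),
      hf _ (Or.inr ((one_le_div h2).2 (by linarith)))]
    simpa using hR
  lift m to ℕ using hm
  have hmem : m ∈ Finset.range (2 ^ j) := Finset.mem_range.2 (by exact_mod_cast hm2)
  have hsup := (ENNReal.ofReal_le_iff_le_toReal hD).1 (le_iSup (fun j : ℕ =>
    ENNReal.ofReal ((2 : ℝ) ^ ((j : ℝ) * s) *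
    (Finset.range (2 ^ j)).sup' (Finset.nonempty_range_iff.mpr (by positivity))
      fun m => |delta2 ((2 : ℝ) ^ (-(j : ℤ) - 1)) f ((2 : ℝ) ^ (-(j : ℤ)) * (m : ℤ))|)) j)
  rw [mul_comm, ← le_div_iff₀ (by positivity), div_eq_mul_inv, ← two_rpow_neg_pow] at hsup
  refine le_trans (le_of_eq ?_) ((Finset.le_sup' (fun m : ℕ =>
    |delta2 ((2 : ℝ) ^ (-(j : ℤ) - 1)) f ((2 : ℝ) ^ (-(j : ℤ)) * (m : ℤ))|) hmem).trans hsup)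
  have hz : (2 : ℝ) ^ (-(j : ℤ) - 1) = (2 ^ (j + 1))⁻¹ := by
    rw [← zpow_natCast, ← zpow_neg]; congr 1; push_cast; ring
  simp only [delta2, hz, zpow_neg, zpow_natCast]
  congr 4
  · field_simp; ring
  · congr 2; field_simp; ring
  · field_simp

/-- Decay of dyadic second differences gives decay of dyadic first differences. -/
theorem abs_dyadic_sub_le {f : ℝ → ℝ} {r M : ℝ} (hr : 1 / 2 < r) (hM : 0 ≤ M)
    (hint : ∀ m : ℤ, f m = 0)
    (hf : ∀ (j : ℕ) (m : ℤ),
      |f ((m + 1) / 2 ^ j) - 2 * f ((2 * m + 1) / 2 ^ (j + 1)) + f (m / 2 ^ j)| ≤ M * r ^ j)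
    (j : ℕ) (m : ℤ) :
    |f ((m + 1) / 2 ^ j) - f (m / 2 ^ j)| ≤ M / (2 * r - 1) * r ^ j := by
  have hr' : 0 < 2 * r - 1 := by linarith
  induction j generalizing m with
  | zero =>
    have := hint (m + 1)
    push_cast at this
    simp only [pow_zero, div_one, this, hint, sub_zero, abs_zero, mul_one]
    positivity
  | succ j ih =>
    have hK : M / (2 * r - 1) * r ^ (j + 1) = (M / (2 * r - 1) * r ^ j + M * r ^ j) / 2 := by
      field_simp; ring
    rw [hK]
    obtain ⟨k, rfl | rfl⟩ := Int.even_or_odd' m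
    · have e : ((2 * k : ℤ) : ℝ) / 2 ^ (j + 1) = k / 2 ^ j := by push_cast; field_simp; ring
      have h1 := abs_le.1 (ih k)
      have h2 := abs_le.1 (hf j k)
      rw [e]
      push_cast
      rw [abs_le]
      constructor <;> linarith [h1.1, h1.2, h2.1, h2.2]
    · have e : (((2 * k + 1 : ℤ) : ℝ) + 1) / 2 ^ (j + 1) = (k + 1) / 2 ^ j := by
        push_cast; field_simp; ring
      have h1 := abs_le.1 (ih k)
      have h2 := abs_le.1 (hf j k)
      rw [e]
      push_cast
      rw [abs_le]
      constructor <;> linarith [h1.1, h1.2, h2.1, h2.2]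

theorem tendsto_floor_two_pow_mul_div (x : ℝ) :
    Filter.Tendsto (fun n : ℕ => (⌊2 ^ n * x⌋ : ℝ) / 2 ^ n) Filter.atTop (nhds x) := by
  have h0 : Filter.Tendsto (fun n : ℕ => x - (1 / 2 : ℝ) ^ n) Filter.atTop (nhds x) := by
    simpa using tendsto_const_nhds.sub
      (tendsto_pow_atTop_nhds_zero_of_lt_one (r := (1 / 2 : ℝ)) (by norm_num) (by norm_num))
  refine tendsto_of_tendsto_of_tendsto_of_le_of_le h0 tendsto_const_nhds (fun n => ?_)
    (fun n => ?_)
  · have h2 : (0 : ℝ) < 2 ^ n := by positivity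
    simp only
    rw [le_div_iff₀ h2, sub_mul, ← mul_pow]
    norm_num
    linarith [Int.lt_floor_add_one (2 ^ n * x)]
  · simp only
    rw [div_le_iff₀ (by positivity), mul_comm]
    exact Int.floor_le _

/-- Chaining: decay of dyadic first differences controls the distance of `f x` to the value of
`f` at the dyadic point of level `j` preceding `x`. -/
theorem abs_sub_dyadic_floor_le {f : ℝ → ℝ} (hc : Continuous f) {r A : ℝ} (hr0 : 0 ≤ r)
    (hr1 : r < 1) (hA : 0 ≤ A)
    (hf : ∀ (j : ℕ) (m : ℤ), |f ((m + 1) / 2 ^ j) - f (m / 2 ^ j)| ≤ A * r ^ j)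
    (j : ℕ) (x : ℝ) :
    |f x - f (⌊2 ^ j * x⌋ / 2 ^ j)| ≤ A / (1 - r) * r ^ j := by
  have hr' : 0 < 1 - r := by linarith
  have step (n : ℕ) : |f (⌊2 ^ (n + 1) * x⌋ / 2 ^ (n + 1)) - f (⌊2 ^ n * x⌋ / 2 ^ n)| ≤
      A * r ^ n := by
    have h2 : (0 : ℝ) < 2 ^ n := by positivity
    have e0 : (⌊2 ^ n * x⌋ : ℝ) / 2 ^ n = ((2 * ⌊2 ^ n * x⌋ : ℤ) : ℝ) / 2 ^ (n + 1) := by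
      push_cast; field_simp; ring
    have hA' : A * r ^ (n + 1) ≤ A * r ^ n :=
      mul_le_mul_of_nonneg_left (pow_le_pow_of_le_one hr0 hr1.le n.le_succ) hA
    have hlo : 2 * ⌊2 ^ n * x⌋ ≤ ⌊2 ^ (n + 1) * x⌋ := by
      rw [Int.le_floor, pow_succ]; push_cast; linarith [Int.floor_le (2 ^ n * x)]
    have hhi : ⌊2 ^ (n + 1) * x⌋ < 2 * ⌊2 ^ n * x⌋ + 2 := by
      rw [Int.floor_lt, pow_succ]; push_cast; linarith [Int.lt_floor_add_one (2 ^ n * x)]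
    rw [e0]
    obtain h | h : ⌊2 ^ (n + 1) * x⌋ = 2 * ⌊2 ^ n * x⌋ ∨
        ⌊2 ^ (n + 1) * x⌋ = 2 * ⌊2 ^ n * x⌋ + 1 := by lia
    · rw [h, sub_self, abs_zero]; positivity
    · have := hf (n + 1) (2 * ⌊2 ^ n * x⌋)
      rw [h, Int.cast_add, Int.cast_one]
      exact this.trans hA'
  have chain (n : ℕ) : |f (⌊2 ^ (j + n) * x⌋ / 2 ^ (j + n)) - f (⌊2 ^ j * x⌋ / 2 ^ j)| ≤
      A / (1 - r) * (r ^ j - r ^ (j + n)) := by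
    induction n with
    | zero => simp
    | succ n ih =>
      have e : A / (1 - r) * (r ^ j - r ^ (j + (n + 1))) =
          A / (1 - r) * (r ^ j - r ^ (j + n)) + A * r ^ (j + n) := by
        field_simp; ring
      rw [e, ← add_assoc]
      linarith [abs_sub_le (f (⌊2 ^ (j + n + 1) * x⌋ / 2 ^ (j + n + 1)))
        (f (⌊2 ^ (j + n) * x⌋ / 2 ^ (j + n))) (f (⌊2 ^ j * x⌋ / 2 ^ j)), step (j + n)]
  have hlim := ((hc.tendsto x).comp (tendsto_floor_two_pow_mul_div x)).comp
    (Filter.tendsto_add_atTop_nat j)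
  refine le_of_tendsto (hlim.sub_const (f (⌊2 ^ j * x⌋ / 2 ^ j))).abs
    (Filter.Eventually.of_forall fun n => ?_)
  simp only [Function.comp, add_comm n j]
  refine (chain n).trans (mul_le_mul_of_nonneg_left ?_ (by positivity))
  linarith [pow_nonneg hr0 (j + n)]

/-- Decay of dyadic first differences of a continuous function vanishing at the integers implies
Hölder continuity. -/
theorem abs_sub_le_of_dyadic_sub_le {s : ℝ} (hs : 0 < s) {f : ℝ → ℝ} (hc : Continuous f)
    (hint : ∀ m : ℤ, f m = 0) {A : ℝ} (hA : 0 ≤ A)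
    (hf : ∀ (j : ℕ) (m : ℤ),
      |f ((m + 1) / 2 ^ j) - f (m / 2 ^ j)| ≤ A * ((2 : ℝ) ^ (-s)) ^ j) (x y : ℝ) :
    |f x - f y| ≤ (1 + 2 / (1 - 2 ^ (-s))) * 2 ^ s * A * |x - y| ^ s := by
  wlog hxy : y ≤ x generalizing x y
  · rw [abs_sub_comm, abs_sub_comm x]
    exact this y x (le_of_not_ge hxy)
  rcases hxy.eq_or_lt with rfl | hlt
  · simp [hs.ne']
  have hr1 : (2 : ℝ) ^ (-s) < 1 := Real.rpow_lt_one_of_one_lt_of_neg (by norm_num) (by linarith)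
  have happrox := abs_sub_dyadic_floor_le hc (by positivity) hr1 hA hf
  have hr1' : 0 < 1 - (2 : ℝ) ^ (-s) := by linarith
  have hpos : 0 < x - y := by linarith
  rw [abs_of_pos hpos]
  obtain ⟨j, hj, hfl⟩ : ∃ j : ℕ, ((2 : ℝ) ^ (j + 1))⁻¹ ≤ x - y ∧
      |f (⌊2 ^ j * x⌋ / 2 ^ j) - f (⌊2 ^ j * y⌋ / 2 ^ j)| ≤ A * ((2 : ℝ) ^ (-s)) ^ j := by
    rcases le_or_gt 1 (x - y) with h1 | h1
    · refine ⟨0, by norm_num; linarith, ?_⟩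
      simpa [hint] using hA
    · obtain ⟨j, hj1, hj2⟩ := exists_nat_pow_near_of_lt_one hpos h1.le
        (show (0 : ℝ) < 1 / 2 by norm_num) (by norm_num)
      refine ⟨j, by simpa using hj1.le, ?_⟩
      have h2 : (0 : ℝ) < 2 ^ j := by positivity
      have hd : 2 ^ j * x ≤ 2 ^ j * y + 1 := by
        rw [one_div, inv_pow] at hj2
        have := mul_le_mul_of_nonneg_left hj2 h2.le
        rw [mul_inv_cancel₀ h2.ne'] at this
        linarith
      have hlo : ⌊2 ^ j * y⌋ ≤ ⌊2 ^ j * x⌋ :=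
        Int.floor_le_floor (mul_le_mul_of_nonneg_left hxy h2.le)
      have hhi : ⌊2 ^ j * x⌋ ≤ ⌊2 ^ j * y⌋ + 1 := by
        rw [← Int.floor_add_one]; exact Int.floor_le_floor hd
      obtain h | h : ⌊2 ^ j * x⌋ = ⌊2 ^ j * y⌋ ∨ ⌊2 ^ j * x⌋ = ⌊2 ^ j * y⌋ + 1 := by lia
      · rw [h, sub_self, abs_zero]; positivity
      · rw [h, Int.cast_add, Int.cast_one]; exact hf j _
  have hrj : ((2 : ℝ) ^ (-s)) ^ j ≤ 2 ^ s * (x - y) ^ s := by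
    have := Real.rpow_le_rpow (by positivity) hj hs.le
    rw [inv_two_pow_rpow, pow_succ, Real.rpow_neg (by norm_num), ← div_eq_mul_inv,
      div_le_iff₀ (by positivity)] at this
    rw [Real.rpow_neg (by norm_num)]
    linarith
  have hx := happrox j x
  have hy := happrox j y
  rw [abs_sub_comm] at hy
  calc |f x - f y| ≤ (1 + 2 / (1 - 2 ^ (-s))) * A * ((2 : ℝ) ^ (-s)) ^ j := by
        have e : (1 + 2 / (1 - 2 ^ (-s))) * A * ((2 : ℝ) ^ (-s)) ^ j =
          A / (1 - 2 ^ (-s)) * ((2 : ℝ) ^ (-s)) ^ j + A * ((2 : ℝ) ^ (-s)) ^ j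
            + A / (1 - 2 ^ (-s)) * ((2 : ℝ) ^ (-s)) ^ j := by ring
        rw [e]
        linarith [abs_sub_le (f x) (f (⌊2 ^ j * x⌋ / 2 ^ j)) (f y),
          abs_sub_le (f (⌊2 ^ j * x⌋ / 2 ^ j)) (f (⌊2 ^ j * y⌋ / 2 ^ j)) (f y)]
    _ ≤ (1 + 2 / (1 - 2 ^ (-s))) * A * (2 ^ s * (x - y) ^ s) :=
        mul_le_mul_of_nonneg_left hrj (by positivity)
    _ = _ := by ring

/-- A continuous function supported in `[0,1]` vanishes outside the open interval. -/
theorem eq_zero_of_support_subset_Icc {f : ℝ → ℝ} (hc : Continuous f)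
    (hf : Function.support f ⊆ Set.Icc 0 1) (x : ℝ) (hx : x ≤ 0 ∨ 1 ≤ x) : f x = 0 := by
  have hsub : Function.support f ⊆ Set.Ioo 0 1 := by
    rw [← interior_Icc]
    exact hc.isOpen_support.subset_interior_iff.2 hf
  by_contra h
  have := hsub (Function.mem_support.2 h)
  rcases hx with hx | hx <;> linarith [this.1, this.2]

/-- Faber–Schauder characterization of Hölder functions supported in `[0,1]`:
for `0 < s < 1` there are `c₁, c₂ > 0` (depending only on `s`) with
`c₁·D(f) ≤ [f]_s ≤ c₂·D(f)` for every continuous `f` with support in `[0,1]`. -/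
theorem faber_holder_characterization (s : ℝ) (hs0 : 0 < s) (hs1 : s < 1) :
    ∃ c₁ > (0 : ℝ), ∃ c₂ > (0 : ℝ), ∀ f : ℝ → ℝ, Continuous f →
      Function.support f ⊆ Set.Icc 0 1 →
      ENNReal.ofReal c₁ * faberCoeffSup s f ≤ holderSeminorm s f ∧
      holderSeminorm s f ≤ ENNReal.ofReal c₂ * faberCoeffSup s f := by
  have hr : 1 / 2 < (2 : ℝ) ^ (-s) := by
    have := Real.rpow_lt_rpow_of_exponent_lt (x := 2) (by norm_num) (neg_lt_neg hs1)
    rwa [Real.rpow_neg_one, ← one_div] at this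
  have hr1 : (2 : ℝ) ^ (-s) < 1 := Real.rpow_lt_one_of_one_lt_of_neg (by norm_num) (by linarith)
  have hr' : 0 < 2 * (2 : ℝ) ^ (-s) - 1 := by linarith
  have hr1' : 0 < 1 - (2 : ℝ) ^ (-s) := by linarith
  have hc₂ : 0 < (1 + 2 / (1 - 2 ^ (-s))) * 2 ^ s / (2 * (2 : ℝ) ^ (-s) - 1) := by positivity
  refine ⟨1 / 2, by norm_num, _, hc₂, fun f hc hsupp => ⟨?_, ?_⟩⟩
  · by_cases hH : holderSeminorm s f = ⊤
    · rw [hH]; exact le_top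
    have h := faberCoeffSup_le_ofReal hs0 ENNReal.toReal_nonneg
      fun x y hxy => abs_sub_le_of_holderSeminorm_ne_top hH hxy
    calc ENNReal.ofReal (1 / 2) * faberCoeffSup s f
        ≤ ENNReal.ofReal (1 / 2) * ENNReal.ofReal (2 * (holderSeminorm s f).toReal) := by gcongr
      _ = holderSeminorm s f := by
        rw [← ENNReal.ofReal_mul (by norm_num), ← mul_assoc]
        norm_num [ENNReal.ofReal_toReal hH]
  · by_cases hD : faberCoeffSup s f = ⊤
    · rw [hD, ENNReal.mul_top (ENNReal.ofReal_pos.2 hc₂).ne']; exact le_top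
    have hzero := eq_zero_of_support_subset_Icc hc hsupp
    have hint (m : ℤ) : f m = 0 := hzero m <| by
      rcases le_or_gt m 0 with h | h
      · exact Or.inl (by exact_mod_cast h)
      · exact Or.inr (by exact_mod_cast h)
    have hdy := abs_dyadic_sub_le hr ENNReal.toReal_nonneg hint (abs_dyadic_delta2_le hD hzero)
    have hA : 0 ≤ (faberCoeffSup s f).toReal / (2 * (2 : ℝ) ^ (-s) - 1) := by positivity
    refine (holderSeminorm_le_ofReal fun x y _ =>
      abs_sub_le_of_dyadic_sub_le hs0 hc hint hA hdy x y).trans (le_of_eq ?_)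
    conv_rhs => rw [← ENNReal.ofReal_toReal hD]
    rw [← ENNReal.ofReal_mul hc₂.le]
    congr 1
    ring
end

section
/- Let n ≥ 1 and 0 < s < 1. There exist constants c₁ > 0 and c₂ > 0, depending only on n and s, such that for every bounded continuous f : ℝⁿ → ℝ one has c₁ · sup_{j∈ℕ₀, m∈ℤⁿ} 2^{js}·[f]_{j,m} ≤ sup_{0<|x−y|≤1} |f(x)−f(y)|/|x−y|^s ≤ c₂ · sup_{j∈ℕ₀, m∈ℤⁿ} 2^{js}·[f]_{j,m}, the inequalities holding in [0,∞] (characterization of the Hölder–Zygmund seminorm of C^s(ℝⁿ) = B^s_{∞,∞}(ℝⁿ) by oscillations over dyadic cubes). -/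
open scoped ENNReal

/-- The dyadic cube `Q_{j,m} = 2^{−j}m + 2^{−j}(0,1)^n` in `ℝⁿ`. -/
def dyadicCube (n : ℕ) (j : ℕ) (m : Fin n → ℤ) : Set (EuclideanSpace ℝ (Fin n)) :=
  {x | ∀ l, (2 : ℝ) ^ (-(j : ℤ)) * m l < x l ∧ x l < (2 : ℝ) ^ (-(j : ℤ)) * (m l + 1)}

/-- The dyadic oscillation `[f]_{j,m} = sup_{Q_{j,m}} f − inf_{Q_{j,m}} f`. -/
noncomputable def dyadicOsc (n : ℕ) (f : EuclideanSpace ℝ (Fin n) → ℝ)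
    (j : ℕ) (m : Fin n → ℤ) : ℝ :=
  sSup (f '' dyadicCube n j m) - sInf (f '' dyadicCube n j m)

/-- Coordinatewise bounds control the Euclidean distance. -/
theorem dist_le_card_mul_of_abs_sub_le {n : ℕ} {x y : EuclideanSpace ℝ (Fin n)} {δ : ℝ}
    (h : ∀ l, |x l - y l| ≤ δ) : dist x y ≤ n * δ := by
  rcases Nat.eq_zero_or_pos n with rfl | hn
  · simp [EuclideanSpace.dist_eq]
  have hδ : 0 ≤ δ := (abs_nonneg _).trans (h ⟨0, hn⟩)
  have hn' : (1 : ℝ) ≤ n := by exact_mod_cast hn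
  rw [EuclideanSpace.dist_eq]
  refine Real.sqrt_le_iff.2 ⟨by positivity, ?_⟩
  calc ∑ l, dist (x l) (y l) ^ 2 ≤ ∑ _l : Fin n, δ ^ 2 := by
        refine Finset.sum_le_sum fun l _ => ?_
        rw [Real.dist_eq]
        exact pow_le_pow_left₀ (abs_nonneg _) (h l) 2
    _ = n * δ ^ 2 := by simp
    _ ≤ (n * δ) ^ 2 := by nlinarith [sq_nonneg δ, mul_nonneg (sub_nonneg.2 hn') (sq_nonneg δ)]

/-- A bound on increments at scale `δ` yields a bound at scale `N * δ`, by subdividing segments. -/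
theorem dist_le_mul_of_dist_le_of_subdivision {E : Type*} [NormedAddCommGroup E]
    [NormedSpace ℝ E] {f : E → ℝ} {N : ℕ} (hN : 1 ≤ N) {δ B : ℝ}
    (h : ∀ u v, dist u v ≤ δ → dist (f u) (f v) ≤ B) {x y : E} (hxy : dist x y ≤ N * δ) :
    dist (f x) (f y) ≤ N * B := by
  have hN' : (0 : ℝ) < N := by exact_mod_cast hN
  have key := dist_le_range_sum_of_dist_le
    (f := fun k : ℕ => f (AffineMap.lineMap x y ((k : ℝ) / N))) (d := fun _ => B) N
    (fun {k} _ => by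
      apply h
      rw [dist_lineMap_lineMap, Real.dist_eq, ← sub_div, abs_div, abs_of_pos hN', Nat.cast_succ,
        sub_add_cancel_left, abs_neg, abs_one, one_div, inv_mul_le_iff₀ hN']
      exact hxy)
  simpa [div_self hN'.ne'] using key

/-- The closed dyadic cube. -/
def closedDyadicCube (n : ℕ) (j : ℕ) (m : Fin n → ℤ) : Set (EuclideanSpace ℝ (Fin n)) :=
  {x | ∀ l, (2 : ℝ) ^ (-(j : ℤ)) * m l ≤ x l ∧ x l ≤ (2 : ℝ) ^ (-(j : ℤ)) * (m l + 1)}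

/-- The centre of a dyadic cube. -/
noncomputable def dyadicCenter (n : ℕ) (j : ℕ) (m : Fin n → ℤ) : EuclideanSpace ℝ (Fin n) :=
  WithLp.toLp 2 fun l => (2 : ℝ) ^ (-(j : ℤ)) * (m l + 1 / 2)

theorem lineMap_dyadicCenter_mem {n j : ℕ} {m : Fin n → ℤ} {x : EuclideanSpace ℝ (Fin n)}
    (hx : x ∈ closedDyadicCube n j m) {t : ℝ} (ht : t ∈ Set.Ioc (0 : ℝ) 1) :
    AffineMap.lineMap x (dyadicCenter n j m) t ∈ dyadicCube n j m := by
  intro l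
  have hδ : (0 : ℝ) < 2 ^ (-(j : ℤ)) := by positivity
  obtain ⟨h1, h2⟩ := hx l
  have e : (AffineMap.lineMap x (dyadicCenter n j m) t : EuclideanSpace ℝ (Fin n)) l
      = (1 - t) * x l + t * ((2 : ℝ) ^ (-(j : ℤ)) * (m l + 1 / 2)) := by
    simp [AffineMap.lineMap_apply, dyadicCenter]
    ring
  rw [e]
  obtain ⟨ht0, ht1⟩ := ht
  have htδ := mul_pos ht0 hδ
  have h3 := mul_le_mul_of_nonneg_left h1 (sub_nonneg.2 ht1)
  have h4 := mul_le_mul_of_nonneg_left h2 (sub_nonneg.2 ht1)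
  constructor <;> nlinarith

theorem dyadicCenter_mem {n j : ℕ} {m : Fin n → ℤ} :
    dyadicCenter n j m ∈ dyadicCube n j m := by
  have hδ : (0 : ℝ) < 2 ^ (-(j : ℤ)) := by positivity
  intro l
  simp only [dyadicCenter]
  constructor <;> nlinarith

theorem abs_sub_le_dyadicOsc {n j : ℕ} {m : Fin n → ℤ} {f : EuclideanSpace ℝ (Fin n) → ℝ} {M : ℝ}
    (hM : ∀ x, |f x| ≤ M) {x y : EuclideanSpace ℝ (Fin n)} (hx : x ∈ dyadicCube n j m)
    (hy : y ∈ dyadicCube n j m) : |f x - f y| ≤ dyadicOsc n f j m := by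
  have ha : BddAbove (f '' dyadicCube n j m) :=
    ⟨M, by rintro _ ⟨z, -, rfl⟩; exact (abs_le.1 (hM z)).2⟩
  have hb : BddBelow (f '' dyadicCube n j m) :=
    ⟨-M, by rintro _ ⟨z, -, rfl⟩; exact (abs_le.1 (hM z)).1⟩
  have h1 := le_csSup ha (Set.mem_image_of_mem f hx)
  have h2 := le_csSup ha (Set.mem_image_of_mem f hy)
  have h3 := csInf_le hb (Set.mem_image_of_mem f hx)
  have h4 := csInf_le hb (Set.mem_image_of_mem f hy)
  rw [dyadicOsc, abs_le]
  constructor <;> linarith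

theorem dyadicOsc_le {n j : ℕ} {m : Fin n → ℤ} {f : EuclideanSpace ℝ (Fin n) → ℝ} {C : ℝ}
    (h : ∀ x ∈ dyadicCube n j m, ∀ y ∈ dyadicCube n j m, |f x - f y| ≤ C) :
    dyadicOsc n f j m ≤ C := by
  have hne : (f '' dyadicCube n j m).Nonempty := ⟨_, _, dyadicCenter_mem, rfl⟩
  rw [dyadicOsc, sub_le_iff_le_add]
  refine csSup_le hne ?_
  rintro _ ⟨x, hx, rfl⟩
  rw [← sub_le_iff_le_add']
  refine le_csInf hne ?_
  rintro _ ⟨y, hy, rfl⟩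
  linarith [(abs_le.1 (h x hx y hy)).2]

/-- The oscillation over the open cube controls increments over the closed cube. -/
theorem abs_sub_le_dyadicOsc_of_mem_closed {n j : ℕ} {m : Fin n → ℤ}
    {f : EuclideanSpace ℝ (Fin n) → ℝ} {M : ℝ} (hM : ∀ x, |f x| ≤ M) (hf : Continuous f)
    {x y : EuclideanSpace ℝ (Fin n)} (hx : x ∈ closedDyadicCube n j m)
    (hy : y ∈ closedDyadicCube n j m) : |f x - f y| ≤ dyadicOsc n f j m := by
  set c := dyadicCenter n j m
  have hcont : Continuous fun t : ℝ =>
      |f (AffineMap.lineMap x c t) - f (AffineMap.lineMap y c t)| :=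
    ((hf.comp AffineMap.lineMap_continuous).sub (hf.comp AffineMap.lineMap_continuous)).abs
  have hlim := (hcont.tendsto 0).mono_left (nhdsWithin_le_nhds (s := Set.Ioi (0 : ℝ)))
  simp only [AffineMap.lineMap_apply_zero] at hlim
  refine le_of_tendsto hlim ?_
  filter_upwards [Ioc_mem_nhdsGT (zero_lt_one (α := ℝ))] with t ht
  exact abs_sub_le_dyadicOsc hM (lineMap_dyadicCenter_mem hx ht) (lineMap_dyadicCenter_mem hy ht)

/-- Two points at distance at most `2^{-j}` lie in closed dyadic cubes of generation `j` that
share a point. -/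
theorem exists_mem_closedDyadicCube_inter {n j : ℕ} {x y : EuclideanSpace ℝ (Fin n)}
    (h : dist x y ≤ (2 : ℝ) ^ (-(j : ℤ))) :
    ∃ m m' : Fin n → ℤ, ∃ z, x ∈ closedDyadicCube n j m ∧ y ∈ closedDyadicCube n j m' ∧
      z ∈ closedDyadicCube n j m ∧ z ∈ closedDyadicCube n j m' := by
  have hδ : (0 : ℝ) < 2 ^ (-(j : ℤ)) := by positivity
  generalize hd : (2 : ℝ) ^ (-(j : ℤ)) = δ at *
  have floor_mem : ∀ a : ℝ, δ * ⌊a / δ⌋ ≤ a ∧ a ≤ δ * (⌊a / δ⌋ + 1) := fun a =>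
    ⟨by rw [mul_comm, ← le_div_iff₀ hδ]; exact Int.floor_le _,
      by rw [mul_comm, ← div_le_iff₀ hδ]; exact (Int.lt_floor_add_one _).le⟩
  have floor_le : ∀ a b : ℝ, |a - b| ≤ δ → ⌊a / δ⌋ ≤ ⌊b / δ⌋ + 1 := fun a b hab => by
    rw [← Int.floor_add_one]
    refine Int.floor_le_floor ?_
    rw [div_add_one hδ.ne', div_le_div_iff_of_pos_right hδ]
    linarith [(abs_le.1 hab).2]
  have hl : ∀ l, |x l - y l| ≤ δ := fun l => by
    have := PiLp.norm_apply_le (x - y) l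
    rw [Real.norm_eq_abs, ← dist_eq_norm] at this
    exact this.trans h
  have max_mem : ∀ a b : ℤ, b ≤ a + 1 →
      δ * a ≤ δ * (max a b : ℤ) ∧ δ * (max a b : ℤ) ≤ δ * (a + 1) := fun a b hab =>
    ⟨mul_le_mul_of_nonneg_left (by exact_mod_cast le_max_left a b) hδ.le,
      mul_le_mul_of_nonneg_left (by exact_mod_cast max_le (by omega) hab) hδ.le⟩
  refine ⟨fun l => ⌊x l / δ⌋, fun l => ⌊y l / δ⌋,
    WithLp.toLp 2 fun l => δ * (max ⌊x l / δ⌋ ⌊y l / δ⌋ : ℤ), ?_, ?_, ?_, ?_⟩ <;> intro l <;>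
    rw [hd]
  · exact floor_mem _
  · exact floor_mem _
  · exact max_mem _ _ (floor_le _ _ (by rw [abs_sub_comm]; exact hl l))
  · dsimp only
    rw [max_comm]
    exact max_mem _ _ (floor_le _ _ (hl l))

theorem two_rpow_mul_zpow_neg_rpow (j : ℕ) (s : ℝ) :
    (2 : ℝ) ^ ((j : ℝ) * s) * ((2 : ℝ) ^ (-(j : ℤ))) ^ s = 1 := by
  rw [Real.rpow_mul zero_le_two, Real.rpow_natCast,
    ← Real.mul_rpow (by positivity) (by positivity), zpow_neg, zpow_natCast,
    mul_inv_cancel₀ (by positivity), Real.one_rpow]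

theorem dyadicOsc_le_of_holder {n : ℕ} (hn : 1 ≤ n) {s H : ℝ} (hs : 0 < s) (hH : 0 ≤ H)
    {f : EuclideanSpace ℝ (Fin n) → ℝ}
    (h : ∀ x y, 0 < dist x y → dist x y ≤ 1 → |f x - f y| ≤ H * dist x y ^ s)
    (j : ℕ) (m : Fin n → ℤ) : (2 : ℝ) ^ ((j : ℝ) * s) * dyadicOsc n f j m ≤ n * H := by
  have hδ : (0 : ℝ) < 2 ^ (-(j : ℤ)) := by positivity
  have hδ1 : (2 : ℝ) ^ (-(j : ℤ)) ≤ 1 := by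
    rw [zpow_neg, zpow_natCast]
    exact inv_le_one_of_one_le₀ (one_le_pow₀ one_le_two)
  have e := two_rpow_mul_zpow_neg_rpow j s
  generalize hd : (2 : ℝ) ^ (-(j : ℤ)) = δ at *
  have hosc : dyadicOsc n f j m ≤ n * (H * δ ^ s) := by
    refine dyadicOsc_le fun x hx y hy => ?_
    refine dist_le_mul_of_dist_le_of_subdivision hn (δ := δ) (fun u v huv => ?_)
      (dist_le_card_mul_of_abs_sub_le fun l => ?_)
    · rcases (dist_nonneg (x := u) (y := v)).eq_or_lt with h0 | h0
      · rw [dist_eq_zero.1 h0.symm, dist_self]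
        positivity
      · exact (h u v h0 (huv.trans hδ1)).trans (by gcongr)
    · have h1 := hx l
      have h2 := hy l
      rw [hd] at h1 h2
      rw [abs_le]
      constructor <;> linarith
  calc _ ≤ (2 : ℝ) ^ ((j : ℝ) * s) * (n * (H * δ ^ s)) := by gcongr
    _ = n * H * ((2 : ℝ) ^ ((j : ℝ) * s) * δ ^ s) := by ring
    _ = n * H := by rw [e, mul_one]

theorem holder_of_dyadicOsc_le {n : ℕ} {s A M : ℝ} (hs0 : 0 < s) (hs1 : s < 1) (hA : 0 ≤ A)
    {f : EuclideanSpace ℝ (Fin n) → ℝ} (hM : ∀ x, |f x| ≤ M) (hf : Continuous f)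
    (h : ∀ (j : ℕ) (m : Fin n → ℤ), (2 : ℝ) ^ ((j : ℝ) * s) * dyadicOsc n f j m ≤ A)
    {x y : EuclideanSpace ℝ (Fin n)} (h0 : 0 < dist x y) (h1 : dist x y ≤ 1) :
    |f x - f y| ≤ 4 * A * dist x y ^ s := by
  obtain ⟨j, hj1, hj2⟩ := exists_nat_pow_near_of_lt_one h0 h1 (one_half_pos (α := ℝ)) one_half_lt_one
  have hδ : (0 : ℝ) < 2 ^ (-(j : ℤ)) := by positivity
  have hpow : (1 / 2 : ℝ) ^ j = 2 ^ (-(j : ℤ)) := by simp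
  obtain ⟨m, m', z, hx, hy, hz, hz'⟩ := exists_mem_closedDyadicCube_inter (hpow ▸ hj2)
  have e := two_rpow_mul_zpow_neg_rpow j s
  rw [pow_succ, hpow] at hj1
  generalize (2 : ℝ) ^ (-(j : ℤ)) = δ at *
  have hosc : ∀ m, dyadicOsc n f j m ≤ A * δ ^ s := fun m => by
    calc dyadicOsc n f j m
        = ((2 : ℝ) ^ ((j : ℝ) * s) * dyadicOsc n f j m) * δ ^ s := by
          rw [mul_right_comm, e, one_mul]
      _ ≤ A * δ ^ s := by gcongr; exact h j m
  have hδs : δ ^ s ≤ 2 * dist x y ^ s := by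
    calc δ ^ s ≤ (2 * dist x y) ^ s := by gcongr; linarith
      _ = 2 ^ s * dist x y ^ s := Real.mul_rpow zero_le_two h0.le
      _ ≤ 2 * dist x y ^ s := by
        gcongr
        calc (2 : ℝ) ^ s ≤ 2 ^ (1 : ℝ) := Real.rpow_le_rpow_of_exponent_le one_le_two hs1.le
          _ = 2 := Real.rpow_one 2
  have a1 := (abs_sub_le_dyadicOsc_of_mem_closed hM hf hx hz).trans (hosc m)
  have a2 := (abs_sub_le_dyadicOsc_of_mem_closed hM hf hz' hy).trans (hosc m')
  calc |f x - f y| ≤ |f x - f z| + |f z - f y| := abs_sub_le _ _ _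
    _ ≤ 2 * A * δ ^ s := by linarith
    _ ≤ 2 * A * (2 * dist x y ^ s) := by gcongr
    _ = _ := by ring

/-- characterization of the Hölder–Zygmund seminorm of
`C^s(ℝⁿ) = B^s_{∞,∞}(ℝⁿ)`, `0 < s < 1`, by oscillations over dyadic cubes:
`sup_{j,m} 2^{js}[f]_{j,m} ∼ sup_{0<|x−y|≤1} |f(x)−f(y)|/|x−y|^s` for bounded
continuous `f`, with equivalence constants depending only on `n` and `s`. -/
theorem holder_zygmund_by_dyadic_osc (n : ℕ) (hn : 1 ≤ n) (s : ℝ)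
    (hs0 : 0 < s) (hs1 : s < 1) :
    ∃ c₁ > (0 : ℝ), ∃ c₂ > (0 : ℝ), ∀ f : EuclideanSpace ℝ (Fin n) → ℝ,
      (∃ M, ∀ x, |f x| ≤ M) → Continuous f →
      ENNReal.ofReal c₁ *
          (⨆ (j : ℕ) (m : Fin n → ℤ),
            ENNReal.ofReal ((2 : ℝ) ^ ((j : ℝ) * s) * dyadicOsc n f j m)) ≤
        (⨆ (p : EuclideanSpace ℝ (Fin n) × EuclideanSpace ℝ (Fin n))
            (_ : 0 < dist p.1 p.2 ∧ dist p.1 p.2 ≤ 1),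
          ENNReal.ofReal (|f p.1 - f p.2| / dist p.1 p.2 ^ s)) ∧
      (⨆ (p : EuclideanSpace ℝ (Fin n) × EuclideanSpace ℝ (Fin n))
          (_ : 0 < dist p.1 p.2 ∧ dist p.1 p.2 ≤ 1),
        ENNReal.ofReal (|f p.1 - f p.2| / dist p.1 p.2 ^ s)) ≤
        ENNReal.ofReal c₂ *
          (⨆ (j : ℕ) (m : Fin n → ℤ),
            ENNReal.ofReal ((2 : ℝ) ^ ((j : ℝ) * s) * dyadicOsc n f j m)) := by
  have hn' : (0 : ℝ) < n := by exact_mod_cast hn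
  refine ⟨(n : ℝ)⁻¹, inv_pos.2 hn', 4, by norm_num, fun f ⟨M, hM⟩ hf => ⟨?_, ?_⟩⟩
  · set S := ⨆ (p : EuclideanSpace ℝ (Fin n) × EuclideanSpace ℝ (Fin n))
      (_ : 0 < dist p.1 p.2 ∧ dist p.1 p.2 ≤ 1),
      ENNReal.ofReal (|f p.1 - f p.2| / dist p.1 p.2 ^ s)
    rcases eq_or_ne S ⊤ with htop | htop
    · rw [htop]
      exact le_top
    have hH : ∀ x y, 0 < dist x y → dist x y ≤ 1 → |f x - f y| ≤ S.toReal * dist x y ^ s := by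
      intro x y h0 h1
      rw [← div_le_iff₀ (by positivity)]
      refine (ENNReal.ofReal_le_iff_le_toReal htop).1 ?_
      exact le_iSup₂_of_le (f := fun (p : EuclideanSpace ℝ (Fin n) × EuclideanSpace ℝ (Fin n))
        (_ : 0 < dist p.1 p.2 ∧ dist p.1 p.2 ≤ 1) =>
          ENNReal.ofReal (|f p.1 - f p.2| / dist p.1 p.2 ^ s)) (x, y) ⟨h0, h1⟩ le_rfl
    simp only [ENNReal.mul_iSup]
    refine iSup₂_le fun j m => ?_
    rw [← ENNReal.ofReal_mul (by positivity)]
    refine (ENNReal.ofReal_le_iff_le_toReal htop).2 ?_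
    rw [inv_mul_le_iff₀ hn']
    exact dyadicOsc_le_of_holder hn hs0 ENNReal.toReal_nonneg hH j m
  · set S := ⨆ (j : ℕ) (m : Fin n → ℤ),
      ENNReal.ofReal ((2 : ℝ) ^ ((j : ℝ) * s) * dyadicOsc n f j m)
    rcases eq_or_ne S ⊤ with htop | htop
    · rw [htop, ENNReal.mul_top (by simp)]
      exact le_top
    have hA : ∀ (j : ℕ) (m : Fin n → ℤ),
        (2 : ℝ) ^ ((j : ℝ) * s) * dyadicOsc n f j m ≤ S.toReal := fun j m =>
      (ENNReal.ofReal_le_iff_le_toReal htop).1 (le_iSup₂_of_le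
        (f := fun (j : ℕ) (m : Fin n → ℤ) =>
          ENNReal.ofReal ((2 : ℝ) ^ ((j : ℝ) * s) * dyadicOsc n f j m)) j m le_rfl)
    refine iSup₂_le fun p hp => ?_
    rw [← ENNReal.ofReal_toReal htop, ← ENNReal.ofReal_mul (by norm_num)]
    refine ENNReal.ofReal_le_ofReal ?_
    have hd := hp.1
    rw [div_le_iff₀ (by positivity)]
    exact holder_of_dyadicOsc_le hs0 hs1 ENNReal.toReal_nonneg hM hf hA hp.1 hp.2
end

section
/- Let g : ℝ → ℝ be a Lipschitz scaling function with constants 0 < L₁ ≤ L₂ < ∞, let n ≥ 1 and 0 < s < 1. Then for every bounded f : ℝⁿ → ℝ one has L₁·‖f‖_{C^s} ≤ ‖g ∘ f‖_{C^s} ≤ L₂·‖f‖_{C^s} in [0,∞]. In particular, f belongs to the Hölder–Zygmund space C^s(ℝⁿ) if, and only if, g ∘ f belongs to it, with equivalent norms (the perfect g-composition property of C^s(ℝⁿ)). -/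
open scoped ENNReal

/-- Pointwise comparison of sizes and increments, up to constants, gives comparison of
Hölder–Zygmund norms. -/
theorem ofReal_mul_hzNorm_le {n : ℕ} {s a b : ℝ} (ha : 0 ≤ a) (hb : 0 ≤ b)
    {u v : EuclideanSpace ℝ (Fin n) → ℝ} (hsize : ∀ x, a * |u x| ≤ b * |v x|)
    (hincr : ∀ x y, a * |u x - u y| ≤ b * |v x - v y|) :
    ENNReal.ofReal a * hzNorm n s u ≤ ENNReal.ofReal b * hzNorm n s v := by
  simp only [hzNorm, mul_add, ENNReal.mul_iSup, ← ENNReal.ofReal_mul ha,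
    ← ENNReal.ofReal_mul hb, ← mul_div_assoc]
  refine add_le_add (iSup_mono fun x => ENNReal.ofReal_le_ofReal (hsize x))
    (iSup₂_mono fun p _ => ENNReal.ofReal_le_ofReal ?_)
  exact div_le_div_of_nonneg_right (hincr p.1 p.2) (Real.rpow_nonneg dist_nonneg s)

/-- A Lipschitz scaling function distorts distances by factors between its constants. -/
theorem abs_sub_bounds_of_scaling {g : ℝ → ℝ} {L₁ L₂ : ℝ} (hL₁ : 0 ≤ L₁)
    (hg : ∀ t₁ t₂ : ℝ, t₁ ≤ t₂ →
      L₁ * (t₂ - t₁) ≤ g t₂ - g t₁ ∧ g t₂ - g t₁ ≤ L₂ * (t₂ - t₁)) (a b : ℝ) :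
    L₁ * |a - b| ≤ |g a - g b| ∧ |g a - g b| ≤ L₂ * |a - b| := by
  wlog hab : b ≤ a generalizing a b
  · simpa only [abs_sub_comm] using this b a (le_of_not_ge hab)
  have h := hg b a hab
  have h₀ : 0 ≤ g a - g b := (mul_nonneg hL₁ (sub_nonneg.2 hab)).trans h.1
  rwa [abs_of_nonneg (sub_nonneg.2 hab), abs_of_nonneg h₀]

/-- the perfect `g`-composition property of `C^s(ℝⁿ)`, `0 < s < 1`: for a
Lipschitz scaling function `g` with constants `0 < L₁ ≤ L₂ < ∞` and every bounded `f`,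
`L₁·‖f‖_{C^s} ≤ ‖g ∘ f‖_{C^s} ≤ L₂·‖f‖_{C^s}` in `[0,∞]`. -/
theorem perfect_g_composition_Cs (g : ℝ → ℝ) (L₁ L₂ : ℝ)
    (hL₁ : 0 < L₁) (hL₁₂ : L₁ ≤ L₂) (hg0 : g 0 = 0)
    (hg : ∀ t₁ t₂ : ℝ, t₁ ≤ t₂ →
      L₁ * (t₂ - t₁) ≤ g t₂ - g t₁ ∧ g t₂ - g t₁ ≤ L₂ * (t₂ - t₁))
    (n : ℕ) (hn : 1 ≤ n) (s : ℝ) (hs0 : 0 < s) (hs1 : s < 1)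
    (f : EuclideanSpace ℝ (Fin n) → ℝ) (hb : ∃ M, ∀ x, |f x| ≤ M) :
    ENNReal.ofReal L₁ * hzNorm n s f ≤ hzNorm n s (g ∘ f) ∧
    hzNorm n s (g ∘ f) ≤ ENNReal.ofReal L₂ * hzNorm n s f := by
  have hincr := abs_sub_bounds_of_scaling hL₁.le hg
  have hsize (t : ℝ) : L₁ * |t| ≤ |g t| ∧ |g t| ≤ L₂ * |t| := by
    simpa [hg0] using hincr t 0
  constructor
  · simpa using ofReal_mul_hzNorm_le (s := s) (u := f) (v := g ∘ f) hL₁.le zero_le_one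
      (fun x => by simpa using (hsize (f x)).1) (fun x y => by simpa using (hincr (f x) (f y)).1)
  · simpa using ofReal_mul_hzNorm_le (s := s) (u := g ∘ f) (v := f) zero_le_one
      (hL₁.le.trans hL₁₂)
      (fun x => by simpa using (hsize (f x)).2) (fun x y => by simpa using (hincr (f x) (f y)).2)
end

section
/- Let g : ℝ → ℝ be a Lipschitz scaling function with constants 0 < L₁ ≤ L₂ < ∞, let n ≥ 1 and 0 < s < 1. Then for every bounded continuous f : ℝⁿ → ℝ one has (L₁/2)·‖f‖_{C^s} ≤ ‖ |g ∘ f| ‖_{C^s} ≤ L₂·‖f‖_{C^s} in [0,∞], where |g ∘ f|(x) = |g(f(x))|. In particular, a real bounded continuous f belongs to the Hölder–Zygmund space C^s(ℝⁿ) if, and only if, |g| ∘ f = |g ∘ f| belongs to it, with equivalent norms (the perfect |g|-composition property of C^s(ℝⁿ)). -/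
open scoped ENNReal

/-- A slope-bounded function with slopes in `[L₁, L₂]`. -/
def HasSlopesBetween (g : ℝ → ℝ) (L₁ L₂ : ℝ) : Prop :=
  ∀ t₁ t₂ : ℝ, t₁ ≤ t₂ → L₁ * (t₂ - t₁) ≤ g t₂ - g t₁ ∧ g t₂ - g t₁ ≤ L₂ * (t₂ - t₁)

namespace HasSlopesBetween

variable {g : ℝ → ℝ} {L₁ L₂ : ℝ}

theorem mul_abs_sub_le (hg : HasSlopesBetween g L₁ L₂) (a b : ℝ) :
    L₁ * |a - b| ≤ |g a - g b| := by
  rcases le_total a b with h | h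
  · rw [abs_sub_comm a b, abs_sub_comm (g a), abs_of_nonneg (sub_nonneg.2 h)]
    exact (hg a b h).1.trans (le_abs_self _)
  · rw [abs_of_nonneg (sub_nonneg.2 h)]
    exact (hg b a h).1.trans (le_abs_self _)

theorem abs_sub_le (hg : HasSlopesBetween g L₁ L₂) (hL₁ : 0 ≤ L₁) (a b : ℝ) :
    |g a - g b| ≤ L₂ * |a - b| := by
  wlog h : b ≤ a generalizing a b
  · rw [abs_sub_comm a b, abs_sub_comm (g a)]
    exact this b a (le_of_not_ge h)
  have hba := hg b a h
  rw [abs_of_nonneg (sub_nonneg.2 h), abs_of_nonneg]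
  · exact hba.2
  · exact (mul_nonneg hL₁ (sub_nonneg.2 h)).trans hba.1

theorem mul_abs_le (hg : HasSlopesBetween g L₁ L₂) (hg0 : g 0 = 0) (a : ℝ) :
    L₁ * |a| ≤ |g a| := by
  simpa [hg0] using hg.mul_abs_sub_le a 0

theorem abs_le (hg : HasSlopesBetween g L₁ L₂) (hL₁ : 0 ≤ L₁) (hg0 : g 0 = 0) (a : ℝ) :
    |g a| ≤ L₂ * |a| := by
  simpa [hg0] using hg.abs_sub_le hL₁ a 0

theorem nonneg (hg : HasSlopesBetween g L₁ L₂) (hL₁ : 0 ≤ L₁) (hg0 : g 0 = 0) {a : ℝ}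
    (ha : 0 ≤ a) : 0 ≤ g a := by
  have := (hg 0 a ha).1
  rw [hg0, sub_zero, sub_zero] at this
  exact (mul_nonneg hL₁ ha).trans this

theorem nonpos (hg : HasSlopesBetween g L₁ L₂) (hL₁ : 0 ≤ L₁) (hg0 : g 0 = 0) {a : ℝ}
    (ha : a ≤ 0) : g a ≤ 0 := by
  have := (hg a 0 ha).1
  rw [hg0, zero_sub, zero_sub] at this
  linarith [mul_nonneg hL₁ (neg_nonneg.2 ha)]

theorem mul_abs_sub_le_abs_abs_sub (hg : HasSlopesBetween g L₁ L₂) (hL₁ : 0 ≤ L₁)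
    (hg0 : g 0 = 0) {a b : ℝ} (hab : 0 ≤ a ∧ 0 ≤ b ∨ a ≤ 0 ∧ b ≤ 0) :
    L₁ * |a - b| ≤ |(|g a| - |g b|)| := by
  refine (hg.mul_abs_sub_le a b).trans_eq ?_
  rcases hab with ⟨ha, hb⟩ | ⟨ha, hb⟩
  · rw [abs_of_nonneg (hg.nonneg hL₁ hg0 ha), abs_of_nonneg (hg.nonneg hL₁ hg0 hb)]
  · rw [abs_of_nonpos (hg.nonpos hL₁ hg0 ha), abs_of_nonpos (hg.nonpos hL₁ hg0 hb),
      neg_sub_neg, abs_sub_comm]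

end HasSlopesBetween

/-- On a segment along which `f` changes sign, the endpoint with the larger absolute value and
a zero of `f` have a difference quotient of `|g ∘ f|` controlling the one of `f`. -/
theorem exists_difference_quotient_le {E : Type*} [NormedAddCommGroup E] [NormedSpace ℝ E]
    {g : ℝ → ℝ} {L₁ L₂ s : ℝ} (hg : HasSlopesBetween g L₁ L₂) (hL₁ : 0 ≤ L₁) (hg0 : g 0 = 0)
    (hs : 0 ≤ s) {f : E → ℝ} (hf : Continuous f) {x y : E} (hxy : 0 < dist x y) :
    ∃ u v : E, (0 < dist u v ∧ dist u v ≤ dist x y) ∧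
      L₁ / 2 * (|f x - f y| / dist x y ^ s) ≤ |(|g (f u)| - |g (f v)|)| / dist u v ^ s := by
  wlog hle : |f y| ≤ |f x| generalizing x y
  · have := this (x := y) (y := x) (by rwa [dist_comm]) (le_of_not_ge hle)
    rwa [dist_comm y x, abs_sub_comm (f y)] at this
  by_cases hsign : 0 ≤ f x ∧ 0 ≤ f y ∨ f x ≤ 0 ∧ f y ≤ 0
  · refine ⟨x, y, ⟨hxy, le_rfl⟩, ?_⟩
    rw [← mul_div_assoc]
    gcongr
    refine le_trans ?_ (hg.mul_abs_sub_le_abs_abs_sub hL₁ hg0 hsign)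
    gcongr
    linarith
  · have hx : f x ≠ 0 := by
      intro h
      rw [h, abs_zero] at hle
      have := abs_nonpos_iff.1 hle
      simp [h, this] at hsign
    obtain ⟨z, hz, hfz⟩ : ∃ z ∈ segment ℝ x y, f z = 0 := by
      have hpre := (convex_segment (𝕜 := ℝ) x y).isPreconnected
      rcases le_total (f x) 0 with h | h
      · have hy : 0 ≤ f y := by by_contra! hy; exact hsign (Or.inr ⟨h, hy.le⟩)
        exact hpre.intermediate_value (left_mem_segment ℝ x y) (right_mem_segment ℝ x y)
          hf.continuousOn ⟨h, hy⟩
      · have hy : f y ≤ 0 := by by_contra! hy; exact hsign (Or.inl ⟨h, hy.le⟩)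
        exact hpre.intermediate_value (right_mem_segment ℝ x y) (left_mem_segment ℝ x y)
          hf.continuousOn ⟨hy, h⟩
    have hpos : 0 < dist x z := by
      refine dist_pos.2 ?_
      rintro rfl
      exact hx hfz
    have hdist : dist x z ≤ dist x y := by
      linarith [dist_add_dist_of_mem_segment hz, dist_nonneg (x := z) (y := y)]
    refine ⟨x, z, ⟨hpos, hdist⟩, ?_⟩
    rw [hfz, hg0, abs_zero, sub_zero, abs_abs, ← mul_div_assoc]
    gcongr
    calc L₁ / 2 * |f x - f y| ≤ L₁ / 2 * (|f x| + |f x|) := by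
          gcongr
          exact (abs_sub _ _).trans (by gcongr)
      _ = L₁ * |f x| := by ring
      _ ≤ |g (f x)| := hg.mul_abs_le hg0 _

/-- the perfect `|g|`-composition property of `C^s(ℝⁿ)`, `0 < s < 1`: for a
Lipschitz scaling function `g` with constants `0 < L₁ ≤ L₂ < ∞` and every bounded
continuous `f`, `(L₁/2)·‖f‖_{C^s} ≤ ‖|g ∘ f|‖_{C^s} ≤ L₂·‖f‖_{C^s}` in `[0,∞]`. -/
theorem perfect_abs_g_composition_Cs (g : ℝ → ℝ) (L₁ L₂ : ℝ)
    (hL₁ : 0 < L₁) (hL₁₂ : L₁ ≤ L₂) (hg0 : g 0 = 0)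
    (hg : ∀ t₁ t₂ : ℝ, t₁ ≤ t₂ →
      L₁ * (t₂ - t₁) ≤ g t₂ - g t₁ ∧ g t₂ - g t₁ ≤ L₂ * (t₂ - t₁))
    (n : ℕ) (hn : 1 ≤ n) (s : ℝ) (hs0 : 0 < s) (hs1 : s < 1)
    (f : EuclideanSpace ℝ (Fin n) → ℝ) (hb : ∃ M, ∀ x, |f x| ≤ M) (hc : Continuous f) :
    ENNReal.ofReal (L₁ / 2) * hzNorm n s f ≤ hzNorm n s (fun x => |g (f x)|) ∧
    hzNorm n s (fun x => |g (f x)|) ≤ ENNReal.ofReal L₂ * hzNorm n s f := by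
  replace hg : HasSlopesBetween g L₁ L₂ := hg
  have hL₂ : 0 ≤ L₂ := hL₁.le.trans hL₁₂
  unfold hzNorm
  simp only [mul_add, ENNReal.mul_iSup, abs_abs]
  constructor
  · refine add_le_add (iSup_mono fun x => ?_) (iSup₂_le fun p hp => ?_)
    · rw [← ENNReal.ofReal_mul (by positivity)]
      refine ENNReal.ofReal_le_ofReal (le_trans ?_ (hg.mul_abs_le hg0 (f x)))
      gcongr
      linarith
    · obtain ⟨u, v, ⟨hpos, hle⟩, huv⟩ :=
        exists_difference_quotient_le hg hL₁.le hg0 hs0.le hc hp.1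
      rw [← ENNReal.ofReal_mul (by positivity)]
      exact (ENNReal.ofReal_le_ofReal huv).trans
        (le_iSup₂_of_le (u, v) ⟨hpos, hle.trans hp.2⟩ le_rfl)
  · refine add_le_add (iSup_mono fun x => ?_) (iSup₂_mono fun p hp => ?_)
    · rw [← ENNReal.ofReal_mul hL₂]
      exact ENNReal.ofReal_le_ofReal (hg.abs_le hL₁.le hg0 (f x))
    · rw [← ENNReal.ofReal_mul hL₂, ← mul_div_assoc]
      refine ENNReal.ofReal_le_ofReal ?_
      gcongr
      exact (abs_abs_sub_abs_le _ _).trans (hg.abs_sub_le hL₁.le _ _)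
end

section
/- Let 1 < p < ∞ and let 0 < L₁ ≤ L₂ < ∞. Let g : ℝ → ℝ be continuously differentiable with L₁ ≤ g′(t) ≤ L₂ for all t ∈ ℝ. Then g is a bijection of ℝ onto ℝ whose inverse g⁻¹ is continuously differentiable, and there is a constant C > 0, depending only on p, L₁ and L₂, such that sup_{h>0} h^{−1/p} ‖(g⁻¹)′(·+h) − (g⁻¹)′(·)‖_{L_p(ℝ)} ≤ C · sup_{h>0} h^{−1/p} ‖g′(·+h) − g′(·)‖_{L_p(ℝ)}, the inequality holding in [0,∞]. In particular, if g′ has finite homogeneous Besov seminorm in Ḃ^{1/p}_{p,∞}(ℝ), then so does (g⁻¹)′. -/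
open MeasureTheory
open scoped ENNReal

/-- The homogeneous Besov seminorm `‖u | Ḃ^σ_{p,∞}(ℝ)‖ = sup_{h>0} h^{−σ}‖u(·+h) − u(·)‖_{L_p}`,
valued in `[0,∞]`. -/
noncomputable def besovSeminorm (p σ : ℝ) (u : ℝ → ℝ) : ℝ≥0∞ :=
  ⨆ (h : ℝ) (_ : 0 < h),
    ENNReal.ofReal (h ^ (-σ)) *
      eLpNorm (fun t => u (t + h) - u t) (ENNReal.ofReal p) volume

/-- The `p`-th power of the `L_p` norm of a difference is controlled by the Besov seminorm of
smoothness `1 / p`. -/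
lemma lintegral_enorm_sub_rpow_le_besovSeminorm {p : ℝ} (hp : 0 < p) (u : ℝ → ℝ) {s : ℝ}
    (hs : 0 < s) :
    ∫⁻ x, ‖u (x + s) - u x‖ₑ ^ p ≤ ENNReal.ofReal s * besovSeminorm p (1 / p) u ^ p := by
  have hle : ENNReal.ofReal (s ^ (-(1 / p))) *
      eLpNorm (fun t => u (t + s) - u t) (ENNReal.ofReal p) volume ≤ besovSeminorm p (1 / p) u :=
    le_iSup₂_of_le s hs le_rfl
  have hpow := ENNReal.rpow_le_rpow hle hp.le
  rw [ENNReal.mul_rpow_of_nonneg _ _ hp.le,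
    ENNReal.ofReal_rpow_of_nonneg (by positivity) hp.le, ← Real.rpow_mul hs.le,
    show -(1 / p) * p = -1 by field_simp, Real.rpow_neg_one,
    eLpNorm_eq_lintegral_rpow_enorm_toReal (by simpa using hp) ENNReal.ofReal_ne_top,
    ENNReal.toReal_ofReal hp.le, ← ENNReal.rpow_mul, one_div, inv_mul_cancel₀ hp.ne',
    ENNReal.rpow_one] at hpow
  calc ∫⁻ x, ‖u (x + s) - u x‖ₑ ^ p
      = ENNReal.ofReal s * (ENNReal.ofReal s⁻¹ * ∫⁻ x, ‖u (x + s) - u x‖ₑ ^ p) := by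
        rw [← mul_assoc, ← ENNReal.ofReal_mul hs.le, mul_inv_cancel₀ hs.ne', ENNReal.ofReal_one,
          one_mul]
    _ ≤ _ := by rw [one_div]; gcongr

/-- A bound on the derivative of `g` bounds the distortion of integrals under composition with a
right inverse of `g`. -/
lemma lintegral_comp_rightInverse_le {g f : ℝ → ℝ} {L : ℝ} (hg : Differentiable ℝ g)
    (hinj : Function.Injective g) (hgf : Function.RightInverse f g)
    (hL : ∀ t, |deriv g t| ≤ L) (G : ℝ → ℝ≥0∞) :
    ∫⁻ y, G (f y) ≤ ENNReal.ofReal L * ∫⁻ x, G x := by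
  have h := lintegral_image_eq_lintegral_abs_deriv_mul (s := Set.univ) MeasurableSet.univ
    (fun x _ => (hg x).hasDerivAt.hasDerivWithinAt) hinj.injOn (fun y => G (f y))
  rw [Set.image_univ_of_surjective hgf.surjective, Measure.restrict_univ] at h
  rw [h, ← lintegral_const_mul' _ _ ENNReal.ofReal_ne_top]
  gcongr with x
  · exact hL x
  · exact (congrArg G (hinj (hgf (g x)))).le

/-- A function with derivative bounded below by a positive constant is bijective. -/
lemma bijective_of_le_deriv {g : ℝ → ℝ} {L : ℝ} (hL : 0 < L) (hg : Differentiable ℝ g)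
    (hd : ∀ t, L ≤ deriv g t) : Function.Bijective g := by
  have hmono : StrictMono g := strictMono_of_deriv_pos fun t => hL.trans_le (hd t)
  have key := fun ⦃x y : ℝ⦄ (h : x ≤ y) => mul_sub_le_image_sub_of_le_deriv hg hd h
  refine ⟨hmono.injective, hg.continuous.surjective ?_ ?_⟩
  · refine Filter.tendsto_atTop_mono' _ (f₁ := fun x => L * x + g 0) ?_
      (Filter.tendsto_atTop_add_const_right _ _ (Filter.tendsto_id.const_mul_atTop hL))
    filter_upwards [Filter.eventually_ge_atTop 0] with x hx
    linarith [key hx]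
  · refine Filter.tendsto_atBot_mono' _ (f₁ := fun x => L * x + g 0) ?_
      (Filter.tendsto_atBot_add_const_right _ _ (Filter.tendsto_id.const_mul_atBot hL))
    filter_upwards [Filter.eventually_le_atBot 0] with x hx
    linarith [key hx]

/-- The inverse of a differentiable function with derivative bounded below by a positive constant
is differentiable. -/
lemma hasDerivAt_rightInverse_of_le_deriv {g f : ℝ → ℝ} {L : ℝ} (hL : 0 < L)
    (hg : Differentiable ℝ g) (hd : ∀ t, L ≤ deriv g t) (hgf : Function.RightInverse f g) (y : ℝ) :
    HasDerivAt f (deriv g (f y))⁻¹ y := by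
  have hmono : StrictMono g := strictMono_of_deriv_pos fun t => hL.trans_le (hd t)
  have hf : Continuous f := by
    refine Monotone.continuous_of_surjective (fun a b hab => ?_)
      (Function.LeftInverse.surjective (g := g) fun x => hmono.injective (hgf (g x)))
    rwa [← hmono.le_iff_le, hgf a, hgf b]
  exact (hg (f y)).hasDerivAt.of_local_left_inverse hf.continuousAt
    (hL.trans_le (hd _)).ne' (Filter.Eventually.of_forall hgf)

/-- The difference of `u` at two points at distance at most `H` is controlled by averages of forward
differences of `u` at these points with steps at most `2 * H`. -/
lemma ofReal_mul_enorm_sub_rpow_le {p : ℝ} (hp : 1 ≤ p) {u : ℝ → ℝ} (hu : Measurable u)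
    {a b H : ℝ} (hab : a ≤ b) (hb : b ≤ a + H) :
    ENNReal.ofReal H * ‖u b - u a‖ₑ ^ p ≤
      2 ^ (p - 1) * ((∫⁻ s in Set.Ioc 0 (2 * H), ‖u (b + s) - u b‖ₑ ^ p) +
        ∫⁻ s in Set.Ioc 0 (2 * H), ‖u (a + s) - u a‖ₑ ^ p) := by
  have hp0 : 0 < p := by linarith
  have hH : 0 ≤ H := by linarith
  have hsub : ∀ c, a ≤ c → c ≤ a + H →
      ∫⁻ z in Set.Ioc (a + H) (a + 2 * H), ‖u z - u c‖ₑ ^ p ≤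
        ∫⁻ s in Set.Ioc 0 (2 * H), ‖u (c + s) - u c‖ₑ ^ p := by
    intro c hac hca
    have htrans := (measurePreserving_add_left volume c).setLIntegral_comp_preimage_emb
      (measurableEmbedding_addLeft c) (fun z => ‖u z - u c‖ₑ ^ p) (Set.Ioc c (c + 2 * H))
    rw [Set.preimage_const_add_Ioc, sub_self, add_sub_cancel_left] at htrans
    rw [htrans]
    exact lintegral_mono_set (Set.Ioc_subset_Ioc hca (by linarith))
  calc ENNReal.ofReal H * ‖u b - u a‖ₑ ^ p
      = ∫⁻ _ in Set.Ioc (a + H) (a + 2 * H), ‖u b - u a‖ₑ ^ p := by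
        rw [setLIntegral_const, Real.volume_Ioc, mul_comm]
        ring_nf
    _ ≤ ∫⁻ z in Set.Ioc (a + H) (a + 2 * H),
          2 ^ (p - 1) * (‖u z - u b‖ₑ ^ p + ‖u z - u a‖ₑ ^ p) := by
        gcongr with z
        refine le_trans ?_ (ENNReal.rpow_add_le_mul_rpow_add_rpow _ _ hp)
        gcongr
        rw [← enorm_neg (u z - u b)]
        exact (congrArg _ (by ring)).trans_le (enorm_add_le _ _)
    _ = 2 ^ (p - 1) * ((∫⁻ z in Set.Ioc (a + H) (a + 2 * H), ‖u z - u b‖ₑ ^ p) +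
          ∫⁻ z in Set.Ioc (a + H) (a + 2 * H), ‖u z - u a‖ₑ ^ p) := by
        rw [lintegral_const_mul _ (by fun_prop), lintegral_add_left (by fun_prop)]
    _ ≤ _ := by
        exact mul_le_mul_right (add_le_add (hsub b hab hb) (hsub a le_rfl (by linarith))) _

/-- Let `f` be the inverse of a function with derivative bounded by `L`, and suppose that `f`
is monotone and moves points at most `H` apart when their distance is `h`.  Then the differences
of `u ∘ f` are controlled by the Besov seminorm of `u`. -/
lemma lintegral_enorm_comp_rightInverse_sub_rpow_le {p : ℝ} (hp : 1 ≤ p) {g f u : ℝ → ℝ}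
    {L h H : ℝ} (hH : 0 < H) (hg : Differentiable ℝ g) (hinj : Function.Injective g)
    (hgf : Function.RightInverse f g) (hL : ∀ t, |deriv g t| ≤ L)
    (hu : Measurable u) (hmono : ∀ y, f y ≤ f (y + h)) (hle : ∀ y, f (y + h) ≤ f y + H)
    (hf : Measurable f) :
    ∫⁻ y, ‖u (f (y + h)) - u (f y)‖ₑ ^ p ≤
      2 ^ p * ENNReal.ofReal (4 * L * H) * besovSeminorm p (1 / p) u ^ p := by
  have hp0 : 0 < p := by linarith
  have hL0 : 0 ≤ L := (abs_nonneg _).trans (hL 0)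
  set M := besovSeminorm p (1 / p) u
  set K : ℝ → ℝ≥0∞ := fun x => ∫⁻ s in Set.Ioc 0 (2 * H), ‖u (x + s) - u x‖ₑ ^ p with hK
  have hKm : Measurable K := Measurable.lintegral_prod_right' (ν := volume.restrict _)
    (f := fun z : ℝ × ℝ => ‖u (z.1 + z.2) - u z.1‖ₑ ^ p) (by fun_prop)
  have hKint : ∫⁻ x, K x ≤ ENNReal.ofReal (2 * H) * M ^ p * ENNReal.ofReal (2 * H) := by
    rw [hK, lintegral_lintegral_swap (by unfold Function.uncurry; fun_prop)]
    calc _ ≤ ∫⁻ _ in Set.Ioc 0 (2 * H), ENNReal.ofReal (2 * H) * M ^ p := by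
          refine setLIntegral_mono measurable_const fun s hs => ?_
          refine (lintegral_enorm_sub_rpow_le_besovSeminorm hp0 u hs.1).trans ?_
          gcongr
          exact hs.2
      _ = _ := by rw [setLIntegral_const, Real.volume_Ioc, sub_zero]
  have hKf : ∫⁻ y, K (f y) ≤
      ENNReal.ofReal L * (ENNReal.ofReal (2 * H) * M ^ p * ENNReal.ofReal (2 * H)) :=
    (lintegral_comp_rightInverse_le hg hinj hgf hL K).trans (by gcongr)
  have hmul : ENNReal.ofReal H * ∫⁻ y, ‖u (f (y + h)) - u (f y)‖ₑ ^ p ≤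
      ENNReal.ofReal H * (2 ^ p * ENNReal.ofReal (4 * L * H) * M ^ p) := by
    calc ENNReal.ofReal H * ∫⁻ y, ‖u (f (y + h)) - u (f y)‖ₑ ^ p
        = ∫⁻ y, ENNReal.ofReal H * ‖u (f (y + h)) - u (f y)‖ₑ ^ p :=
          (lintegral_const_mul' _ _ ENNReal.ofReal_ne_top).symm
      _ ≤ ∫⁻ y, 2 ^ (p - 1) * (K (f (y + h)) + K (f y)) :=
          lintegral_mono fun y => ofReal_mul_enorm_sub_rpow_le hp hu (hmono y) (hle y)
      _ = 2 ^ (p - 1) * (2 * ∫⁻ y, K (f y)) := by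
          rw [lintegral_const_mul _ (by fun_prop), lintegral_add_left (by fun_prop),
            lintegral_add_right_eq_self (fun y => K (f y)) h, two_mul]
      _ ≤ 2 ^ (p - 1) * (2 * (ENNReal.ofReal L *
            (ENNReal.ofReal (2 * H) * M ^ p * ENNReal.ofReal (2 * H)))) := by gcongr
      _ = ENNReal.ofReal H * (2 ^ p * ENNReal.ofReal (4 * L * H) * M ^ p) := by
          have h2 : (2 : ℝ≥0∞) ^ p = 2 ^ (p - 1) * 2 := by
            have := ENNReal.rpow_add (p - 1) 1 (x := 2) (by simp) (by simp)
            rwa [sub_add_cancel, ENNReal.rpow_one] at this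
          have h4 : ENNReal.ofReal (4 * L * H) = 4 * ENNReal.ofReal L * ENNReal.ofReal H := by
            rw [ENNReal.ofReal_mul (by positivity), ENNReal.ofReal_mul (by positivity)]
            simp
          have h2H : ENNReal.ofReal (2 * H) = 2 * ENNReal.ofReal H := by
            rw [ENNReal.ofReal_mul (by positivity)]
            simp
          rw [h2, h4, h2H]
          ring
  exact (ENNReal.mul_le_mul_iff_right (by simpa using hH) ENNReal.ofReal_ne_top).1 hmul

/-- for `1 < p < ∞` and `g : ℝ → ℝ` continuously differentiable with
`L₁ ≤ g′ ≤ L₂` (where `0 < L₁ ≤ L₂ < ∞`), `g` is a bijection of `ℝ` onto `ℝ`, its inverse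
is continuously differentiable, and there is `C > 0` depending only on `p, L₁, L₂` with
`‖(g⁻¹)′ | Ḃ^{1/p}_{p,∞}(ℝ)‖ ≤ C·‖g′ | Ḃ^{1/p}_{p,∞}(ℝ)‖` in `[0,∞]`. -/
theorem inverse_besov_seminorm_bound (p L₁ L₂ : ℝ)
    (hp : 1 < p) (hL₁ : 0 < L₁) (hL₁₂ : L₁ ≤ L₂) :
    ∃ C > (0 : ℝ), ∀ g : ℝ → ℝ, ContDiff ℝ 1 g →
      (∀ t, L₁ ≤ deriv g t) → (∀ t, deriv g t ≤ L₂) →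
      Function.Bijective g ∧ ContDiff ℝ 1 (Function.invFun g) ∧
      besovSeminorm p (1 / p) (deriv (Function.invFun g)) ≤
        ENNReal.ofReal C * besovSeminorm p (1 / p) (deriv g) := by
  have hp0 : 0 < p := by linarith
  have hL₂ : 0 < L₂ := by linarith
  refine ⟨(L₁ ^ 2)⁻¹ * (2 * (4 * L₂ / L₁) ^ (1 / p)), by positivity, fun g hg hlo hhi => ?_⟩
  have hgd : Differentiable ℝ g := hg.differentiable one_ne_zero
  have hbij := bijective_of_le_deriv hL₁ hgd hlo
  set f := Function.invFun g
  have hgf : Function.RightInverse f g := Function.rightInverse_invFun hbij.surjective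
  have hfd := hasDerivAt_rightInverse_of_le_deriv hL₁ hgd hlo hgf
  have hf_deriv : deriv f = fun y => (deriv g (f y))⁻¹ := funext fun y => (hfd y).deriv
  have hf_diff : Differentiable ℝ f := fun y => (hfd y).differentiableAt
  have hu : Continuous (deriv g) := hg.continuous_deriv le_rfl
  have hpos : ∀ t, 0 < deriv g t := fun t => hL₁.trans_le (hlo t)
  refine ⟨hbij, contDiff_one_iff_deriv.2 ⟨hf_diff, ?_⟩, ?_⟩
  · rw [hf_deriv]
    exact (hu.comp hf_diff.continuous).inv₀ fun y => (hpos _).ne'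
  refine iSup₂_le fun h hh => ?_
  have hmono : ∀ y, f y ≤ f (y + h) := fun y =>
    (strictMono_of_deriv_pos hpos).le_iff_le.1 (by rw [hgf, hgf]; linarith)
  have hle : ∀ y, f (y + h) ≤ f y + h / L₁ := fun y => by
    have := mul_sub_le_image_sub_of_le_deriv hgd hlo (hmono y)
    rw [hgf, hgf, add_sub_cancel_left, mul_comm, ← le_div_iff₀ hL₁] at this
    linarith
  have hint := lintegral_enorm_comp_rightInverse_sub_rpow_le hp.le (div_pos hh hL₁) hgd
    hbij.injective hgf (fun t => abs_le.2 ⟨by linarith [hpos t], hhi t⟩) hu.measurable hmono hle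
    hf_diff.continuous.measurable
  have hnorm : eLpNorm (fun t => deriv f (t + h) - deriv f t) (ENNReal.ofReal p) volume ≤
      ENNReal.ofReal (L₁ ^ 2)⁻¹ *
        eLpNorm (fun t => deriv g (f (t + h)) - deriv g (f t)) (ENNReal.ofReal p) volume := by
    refine eLpNorm_le_mul_eLpNorm_of_ae_le_mul (Filter.Eventually.of_forall fun t => ?_) _
    rw [hf_deriv, Real.norm_eq_abs, Real.norm_eq_abs,
      inv_sub_inv (hpos _).ne' (hpos _).ne', abs_div, abs_sub_comm, div_eq_inv_mul]
    gcongr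
    rw [abs_of_pos (mul_pos (hpos _) (hpos _)), pow_two]
    exact mul_le_mul (hlo _) (hlo _) hL₁.le (hpos _).le
  set M := besovSeminorm p (1 / p) (deriv g)
  have hroot : eLpNorm (fun t => deriv g (f (t + h)) - deriv g (f t)) (ENNReal.ofReal p) volume ≤
      2 * ENNReal.ofReal ((4 * L₂ / L₁) ^ (1 / p) * h ^ (1 / p)) * M := by
    rw [eLpNorm_eq_lintegral_rpow_enorm_toReal (by simpa using hp0) ENNReal.ofReal_ne_top,
      ENNReal.toReal_ofReal hp0.le]
    refine (ENNReal.rpow_le_rpow hint (by positivity)).trans_eq ?_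
    rw [ENNReal.mul_rpow_of_nonneg _ _ (by positivity),
      ENNReal.mul_rpow_of_nonneg _ _ (by positivity), ← ENNReal.rpow_mul, ← ENNReal.rpow_mul,
      mul_one_div_cancel hp0.ne', ENNReal.rpow_one, ENNReal.rpow_one,
      ENNReal.ofReal_rpow_of_nonneg (by positivity) (by positivity),
      ← Real.mul_rpow (by positivity) hh.le, mul_div_assoc', div_mul_eq_mul_div]
  calc ENNReal.ofReal (h ^ (-(1 / p))) *
        eLpNorm (fun t => deriv f (t + h) - deriv f t) (ENNReal.ofReal p) volume
      ≤ ENNReal.ofReal (h ^ (-(1 / p))) * (ENNReal.ofReal (L₁ ^ 2)⁻¹ *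
          (2 * ENNReal.ofReal ((4 * L₂ / L₁) ^ (1 / p) * h ^ (1 / p)) * M)) := by
        gcongr
        exact hnorm.trans (by gcongr)
    _ = ENNReal.ofReal ((L₁ ^ 2)⁻¹ * (2 * (4 * L₂ / L₁) ^ (1 / p))) * M := by
        rw [← ENNReal.ofReal_ofNat 2, ← mul_assoc, ← mul_assoc,
          ← ENNReal.ofReal_mul (by positivity), ← ENNReal.ofReal_mul (by positivity),
          ← ENNReal.ofReal_mul (by positivity)]
        congr 2
        rw [Real.rpow_neg hh.le]
        have := (Real.rpow_pos_of_pos hh (1 / p)).ne'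
        field_simp
end
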